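/- Let F be an algebraically closed field of characteristic 2, let 11 ≤ m, and let A_m act naturally and faithfully on a set Ω with |Ω| = n > m, where either Ω is the set of k-element subsets of Δ = {1,…,m} with 2 ≤ k < m/2, or Ω is the set of partitions of Δ into b subsets of size a for integers a, b ≥ 2 with ab = m. Let X ≤ Alt(Ω) be the image of A_m under this action. Then for every F Alt(Ω)-module V with dim_F V > 1, the restriction of V to X is a reducible F X-module. -/

import Mathlib

open scoped Pointwise

/-- A submodule is invariant under a representation. -/
def RepInvariant {F G V : Type*} [Field F] [Monoid G] [AddCommGroup V] [Module F V]
    (ρ : Representation F G V) (p : Submodule F V) : Prop :=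
  ∀ g : G, ∀ v ∈ p, ρ g v ∈ p

/-- A representation is irreducible if the space is nonzero and the only invariant
submodules are `⊥` and `⊤`. -/
def RepIrreducible {F G V : Type*} [Field F] [Monoid G] [AddCommGroup V] [Module F V]
    (ρ : Representation F G V) : Prop :=
  Nontrivial V ∧ ∀ p : Submodule F V, RepInvariant ρ p → p = ⊥ ∨ p = ⊤

/-- The set of `k`-element subsets of `{1, ..., m}`. -/
abbrev KSub (m k : ℕ) := {A : Finset (Fin m) // A.card = k}

instance (m k : ℕ) : MulAction (Equiv.Perm (Fin m)) (KSub m k) where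
  smul g A := ⟨g • A.1, by rw [Finset.card_smul_finset]; exact A.2⟩
  one_smul A := Subtype.ext (one_smul _ A.1)
  mul_smul g h A := Subtype.ext (mul_smul g h A.1)

/-- `P` is a partition of `{1, ..., m}` into `b` subsets of size `a`. -/
def IsPartitionOf (m a b : ℕ) (P : Finset (Finset (Fin m))) : Prop :=
  P.card = b ∧ (∀ A ∈ P, A.card = a) ∧ ∀ i : Fin m, ∃! A, A ∈ P ∧ i ∈ A

lemma IsPartitionOf.smul {m a b : ℕ} {P : Finset (Finset (Fin m))}
    (hP : IsPartitionOf m a b P) (g : Equiv.Perm (Fin m)) :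
    IsPartitionOf m a b (g • P) := by
  obtain ⟨hcard, hsize, hcover⟩ := hP
  refine ⟨by rw [Finset.card_smul_finset]; exact hcard, ?_, ?_⟩
  · intro A hA
    rw [Finset.mem_smul_finset] at hA
    obtain ⟨B, hB, rfl⟩ := hA
    rw [Finset.card_smul_finset]
    exact hsize B hB
  · intro i
    obtain ⟨A, hA, huniq⟩ := hcover (g⁻¹ • i)
    refine ⟨g • A, ⟨Finset.smul_mem_smul_finset hA.1, Finset.inv_smul_mem_iff.mp hA.2⟩, ?_⟩
    intro B hB
    rw [Finset.mem_smul_finset] at hB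
    obtain ⟨⟨C, hC, rfl⟩, hiB⟩ := hB
    rw [huniq C ⟨hC, Finset.inv_smul_mem_iff.mpr hiB⟩]

/-- The set of partitions of `{1, ..., m}` into `b` subsets of size `a`. -/
abbrev Partn (m a b : ℕ) := {P : Finset (Finset (Fin m)) // IsPartitionOf m a b P}

instance (m a b : ℕ) : MulAction (Equiv.Perm (Fin m)) (Partn m a b) where
  smul g P := ⟨g • P.1, P.2.smul g⟩
  one_smul P := Subtype.ext (one_smul _ P.1)
  mul_smul g h P := Subtype.ext (mul_smul g h P.1)

noncomputable instance (m a b : ℕ) : Fintype (Partn m a b) := Fintype.ofFinite _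

section RepresentationBasics

variable {F G V : Type*} [Field F] [Group G] [AddCommGroup V] [Module F V]

lemma RepIrreducible.finiteDimensional [Finite G] {ρ : Representation F G V}
    (h : RepIrreducible ρ) : FiniteDimensional F V := by
  obtain ⟨hV, hp⟩ := h
  obtain ⟨v, hv⟩ := exists_ne (0 : V)
  let p := Submodule.span F (Set.range fun g => ρ g v)
  have hinv : RepInvariant ρ p := by
    intro g w hw
    induction hw using Submodule.span_induction with
    | mem w hw =>
      obtain ⟨x, rfl⟩ := hw
      refine Submodule.subset_span ⟨g * x, ?_⟩
      simp
    | zero => simp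
    | add x y _ _ hx hy => rw [map_add]; exact p.add_mem hx hy
    | smul c x _ hx => rw [map_smul]; exact p.smul_mem c hx
  have hvp : v ∈ p := Submodule.subset_span ⟨1, by simp⟩
  have : p = ⊤ := (hp p hinv).resolve_left fun h0 => hv (by simpa [h0] using hvp)
  exact ⟨this ▸ Submodule.fg_span (Set.finite_range _)⟩

lemma RepIrreducible.isIrreducible {ρ : Representation F G V}
    (h : RepIrreducible ρ) : ρ.IsIrreducible := by
  obtain ⟨hV, hp⟩ := h
  refine { exists_pair_ne := ⟨⊥, ⊤, ?_⟩, eq_bot_or_eq_top := ?_ }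
  · intro h0
    obtain ⟨v, hv⟩ := exists_ne (0 : V)
    have : v ∈ (⊥ : Subrepresentation ρ).toSubmodule := by rw [h0]; trivial
    exact hv ((Submodule.mem_bot F).mp this)
  · intro p
    rcases hp p.toSubmodule (fun g v hv => p.apply_mem_toSubmodule g hv) with h | h
    · left; exact Subrepresentation.toSubmodule_injective h
    · right; exact Subrepresentation.toSubmodule_injective h

lemma RepIrreducible.exists_eq_smul_one [IsAlgClosed F] [Finite G] {ρ : Representation F G V}
    (h : RepIrreducible ρ) (f : Module.End F V) (hf : ∀ g, f * ρ g = ρ g * f) :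
    ∃ c : F, f = c • 1 := by
  have := h.finiteDimensional
  have := h.1
  obtain ⟨c, hc⟩ := Module.End.exists_eigenvalue f
  refine ⟨c, ?_⟩
  have hinv : RepInvariant ρ (f.eigenspace c) := by
    intro g v hv
    rw [Module.End.mem_eigenspace_iff] at hv ⊢
    have := LinearMap.congr_fun (hf g) v
    simp only [Module.End.mul_apply] at this
    rw [this, hv, map_smul]
  have htop := (h.2 _ hinv).resolve_left hc
  ext v
  have : v ∈ f.eigenspace c := by rw [htop]; trivial
  simpa using Module.End.mem_eigenspace_iff.mp this

lemma RepIrreducible.finrank_sq_le_card [IsAlgClosed F] [Finite G] {ρ : Representation F G V}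
    (h : RepIrreducible ρ) : Module.finrank F V ^ 2 ≤ Nat.card G := by
  have := h.finiteDimensional
  have hirr := h.isIrreducible
  have := (Representation.irreducible_iff_isSimpleModule_asModule ρ).mp hirr
  have hfin : Fintype G := Fintype.ofFinite G
  classical
  have hsurj : Function.Surjective ρ.asAlgebraHom := by
    intro f
    have hcomm : ∀ (e : Module.End (MonoidAlgebra F G) ρ.asModule), ∃ c : F, ∀ v : V,
        ρ.asModuleEquiv (e (ρ.asModuleEquiv.symm v)) = c • v := by
      intro e
      let e' : Module.End F V :=
        { toFun := fun v => ρ.asModuleEquiv (e (ρ.asModuleEquiv.symm v))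
          map_add' := by intro x y; simp
          map_smul' := by
            intro c x
            have : (ρ.asModuleEquiv.symm (c • x) : ρ.asModule) =
                (algebraMap F (MonoidAlgebra F G) c) • ρ.asModuleEquiv.symm x :=
              Representation.asModuleEquiv_symm_map_smul ρ c x
            rw [this, map_smul, Representation.asModuleEquiv_map_smul]
            simp }
      obtain ⟨c, hc⟩ := h.exists_eq_smul_one e' (by
        intro g
        ext v
        show ρ.asModuleEquiv (e (ρ.asModuleEquiv.symm (ρ g v))) =
          ρ g (ρ.asModuleEquiv (e (ρ.asModuleEquiv.symm v)))
        rw [Representation.asModuleEquiv_symm_map_rho, map_smul,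
          Representation.asModuleEquiv_map_smul]
        simp)
      exact ⟨c, fun v => LinearMap.congr_fun hc v⟩
    let f' : Module.End (Module.End (MonoidAlgebra F G) ρ.asModule) ρ.asModule :=
      { toFun := fun x => ρ.asModuleEquiv.symm (f (ρ.asModuleEquiv x))
        map_add' := by intro x y; simp
        map_smul' := by
          intro e x
          obtain ⟨c, hc⟩ := hcomm e
          apply ρ.asModuleEquiv.injective
          have h1 := hc (ρ.asModuleEquiv x)
          have h2 := hc (f (ρ.asModuleEquiv x))
          rw [LinearEquiv.symm_apply_apply] at h1
          simp only [Module.End.smul_def, RingHom.id_apply]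
          rw [h1, h2]
          simp }
    let b := Module.finBasis F V
    obtain ⟨r, hr⟩ := jacobson_density f' (Finset.univ.image fun i => ρ.asModuleEquiv.symm (b i))
    refine ⟨r, b.ext fun i => ?_⟩
    have h1 := hr (ρ.asModuleEquiv.symm (b i)) (by simp)
    have h2 := congrArg ρ.asModuleEquiv h1
    rw [Representation.asModuleEquiv_map_smul] at h2
    simpa [f'] using h2.symm
  have h1 : Module.finrank F (Module.End F V) ≤ Module.finrank F (MonoidAlgebra F G) :=
    LinearMap.finrank_le_finrank_of_surjective (f := ρ.asAlgebraHom.toLinearMap) hsurj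
  rw [Module.finrank_linearMap] at h1
  have h2 : Module.finrank F (MonoidAlgebra F G) = Nat.card G := by
    rw [Nat.card_eq_fintype_card]
    exact Module.finrank_eq_card_basis (MonoidAlgebra.basis G F)
  rw [sq]; omega

end RepresentationBasics

section AlternatingOperators

lemma swap_mul_swap_mul_self {Ω : Type*} [DecidableEq Ω] {a b c : Ω} (hab : a ≠ b) (hac : a ≠ c) (hbc : b ≠ c) :
    (Equiv.swap a b * Equiv.swap b c) * (Equiv.swap a b * Equiv.swap b c) = Equiv.swap b c * Equiv.swap a b := by
  ext x
  simp only [Equiv.Perm.mul_apply]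
  simp only [Equiv.swap_apply_def]
  grind

open Equiv Equiv.Perm

variable {Ω : Type*} [Fintype Ω] [DecidableEq Ω]

lemma exists_notMem_of_length_lt_card (l : List Ω) (h : l.length < Fintype.card Ω) :
    ∃ x, x ∉ l := by
  by_contra! hl
  have h1 : l.toFinset = Finset.univ := by ext x; simp [hl x]
  have h2 := l.toFinset_card_le
  rw [h1, Finset.card_univ] at h2
  omega

lemma exists_even_map_eq {l l' : List Ω} (hl : l.Nodup) (hl' : l'.Nodup)
    (hlen : l.length = l'.length) (hcard : l.length + 2 ≤ Fintype.card Ω) :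
    ∃ σ ∈ alternatingGroup Ω, l.map σ = l' := by
  have hpre : MulAction.IsMultiplyPretransitive (alternatingGroup Ω) Ω l.length := by
    have := alternatingGroup.isMultiplyPretransitive Ω
    refine MulAction.isMultiplyPretransitive_of_le (n := Nat.card Ω - 2) ?_ ?_
    · rw [Nat.card_eq_fintype_card]; omega
    · simp
  obtain ⟨σ, hσ⟩ := (MulAction.isMultiplyPretransitive_iff).mp hpre
    ⟨l.get, List.nodup_iff_injective_get.mp hl⟩
    ⟨fun i => l'.get (i.cast hlen), fun i j hij => by
      have := List.nodup_iff_injective_get.mp hl' hij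
      simpa using this⟩
  refine ⟨σ, σ.2, List.ext_get (by simpa using hlen) fun i h1 h2 => ?_⟩
  have := DFunLike.congr_fun hσ ⟨i, by simpa using h1⟩
  simpa [Subgroup.smul_def] using this

variable {F V : Type*} [Field F] [AddCommGroup V] [Module F V]

open Classical in
/-- The operator by which an even permutation acts, and zero for odd permutations. -/
noncomputable def altOp (ρ : Representation F (alternatingGroup Ω) V) (σ : Perm Ω) :
    Module.End F V :=
  if h : σ ∈ alternatingGroup Ω then ρ ⟨σ, h⟩ else 0

variable (ρ : Representation F (alternatingGroup Ω) V)

lemma altOp_of_mem {σ : Perm Ω} (h : σ ∈ alternatingGroup Ω) : altOp ρ σ = ρ ⟨σ, h⟩ :=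
  dif_pos h

lemma altOp_one : altOp ρ 1 = 1 := by
  rw [altOp_of_mem ρ (one_mem _)]
  exact map_one ρ

lemma altOp_mul {σ : Perm Ω} (hσ : σ ∈ alternatingGroup Ω) (τ : Perm Ω) :
    altOp ρ (σ * τ) = altOp ρ σ * altOp ρ τ := by
  by_cases hτ : τ ∈ alternatingGroup Ω
  · rw [altOp_of_mem ρ hσ, altOp_of_mem ρ hτ, altOp_of_mem ρ (mul_mem hσ hτ), ← map_mul]
    rfl
  · have : σ * τ ∉ alternatingGroup Ω := fun h => hτ ((Subgroup.mul_mem_cancel_left _ hσ).mp h)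
    rw [altOp, altOp, altOp, dif_neg this, dif_neg hτ, mul_zero]

lemma altOp_mul' (σ : Perm Ω) {τ : Perm Ω} (hτ : τ ∈ alternatingGroup Ω) :
    altOp ρ (σ * τ) = altOp ρ σ * altOp ρ τ := by
  by_cases hσ : σ ∈ alternatingGroup Ω
  · exact altOp_mul ρ hσ τ
  · have : σ * τ ∉ alternatingGroup Ω := fun h => hσ ((Subgroup.mul_mem_cancel_right _ hτ).mp h)
    rw [altOp, altOp, altOp, dif_neg this, dif_neg hσ, zero_mul]

lemma altOp_mul_altOp_inv {σ : Perm Ω} (hσ : σ ∈ alternatingGroup Ω) :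
    altOp ρ σ * altOp ρ σ⁻¹ = 1 := by
  rw [← altOp_mul ρ hσ, mul_inv_cancel, altOp_one]

lemma altOp_inv_mul_altOp {σ : Perm Ω} (hσ : σ ∈ alternatingGroup Ω) :
    altOp ρ σ⁻¹ * altOp ρ σ = 1 := by
  rw [← altOp_mul' ρ _ hσ, inv_mul_cancel, altOp_one]

lemma swap_mul_swap_mem_alternatingGroup {a b c d : Ω} (hab : a ≠ b) (hcd : c ≠ d) :
    swap a b * swap c d ∈ alternatingGroup Ω := by
  rw [mem_alternatingGroup, map_mul, sign_swap hab, sign_swap hcd]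
  rfl

lemma eq_zero_of_three_cycles_fix {X : Subgroup (Perm Ω)} {hX : X ≤ alternatingGroup Ω}
    (hirr : RepIrreducible (ρ.comp (Subgroup.inclusion hX))) (hV : 1 < Module.rank F V) {v : V}
    (hv : ∀ a b c, [a, b, c].Nodup → altOp ρ (swap a b * swap b c) v = v) : v = 0 := by
  have hfix : ∀ σ ∈ alternatingGroup Ω, altOp ρ σ v = v := by
    intro σ hσ
    rw [← closure_three_cycles_eq_alternating] at hσ
    refine (Subgroup.closure_induction (p := fun σ _ => σ ∈ alternatingGroup Ω ∧ altOp ρ σ v = v)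
      ?_ ?_ ?_ ?_ hσ).2
    · intro σ hσ
      refine ⟨IsThreeCycle.mem_alternatingGroup hσ, ?_⟩
      have h1 := hσ.card_support
      obtain ⟨a, ha⟩ : σ.support.Nonempty := by
        rw [← Finset.card_pos]; omega
      have h2 := (IsThreeCycle.nodup_iff_mem_support hσ).mpr ha
      have h3 := (IsThreeCycle.eq_swap_mul_swap_iff_mem_support hσ).mpr ha
      rw [h3]
      exact hv _ _ _ h2
    · exact ⟨one_mem _, by rw [altOp_one]; rfl⟩
    · rintro x y _ _ ⟨hx, hxv⟩ ⟨hy, hyv⟩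
      refine ⟨mul_mem hx hy, ?_⟩
      rw [altOp_mul ρ hx, Module.End.mul_apply, hyv, hxv]
    · rintro x _ ⟨hx, hxv⟩
      refine ⟨inv_mem hx, ?_⟩
      have := LinearMap.congr_fun (altOp_inv_mul_altOp ρ hx) v
      rwa [Module.End.mul_apply, hxv] at this
  by_contra hv0
  have hinv : RepInvariant (ρ.comp (Subgroup.inclusion hX)) (F ∙ v) := by
    intro g w hw
    obtain ⟨c, rfl⟩ := Submodule.mem_span_singleton.mp hw
    rw [map_smul]
    have := hfix g (hX g.2)
    rw [altOp_of_mem ρ (hX g.2)] at this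
    have h2 : (ρ.comp (Subgroup.inclusion hX)) g v = v := this
    rw [h2]
    exact hw
  rcases hirr.2 _ hinv with h | h
  · exact hv0 (by simpa using h)
  · have h1 : Module.rank F (F ∙ v) ≤ 1 := rank_span_le _ |>.trans (by simp)
    rw [h, rank_top] at h1
    exact absurd hV h1.not_gt

lemma three_cycle_sum_eq_zero_of_range_eq {X : Subgroup (Perm Ω)} {hX : X ≤ alternatingGroup Ω}
    (hirr : RepIrreducible (ρ.comp (Subgroup.inclusion hX))) (hV : 1 < Module.rank F V)
    (R : Submodule F V)
    (hR : ∀ a b c, [a, b, c].Nodup → LinearMap.range (1 + altOp ρ (swap a b * swap b c) +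
      altOp ρ (swap a b * swap b c) * altOp ρ (swap a b * swap b c)) = R)
    {a b c : Ω} (habc : [a, b, c].Nodup) :
    1 + altOp ρ (swap a b * swap b c) +
      altOp ρ (swap a b * swap b c) * altOp ρ (swap a b * swap b c) = 0 := by
  rw [← LinearMap.range_eq_bot, hR a b c habc, eq_bot_iff]
  intro w hw
  refine eq_zero_of_three_cycles_fix ρ hirr hV fun x y z hxyz => ?_
  rw [← hR x y z hxyz] at hw
  obtain ⟨u, rfl⟩ := hw
  simp only [List.nodup_cons, List.mem_cons, List.not_mem_nil, or_false, not_or] at hxyz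
  have hmem := swap_mul_swap_mem_alternatingGroup (Ω := Ω) hxyz.1.1 hxyz.2.1
  have hcube : altOp ρ (swap x y * swap y z) * (altOp ρ (swap x y * swap y z) *
      altOp ρ (swap x y * swap y z)) = 1 := by
    rw [← altOp_mul ρ hmem, ← altOp_mul ρ hmem,
      swap_mul_swap_mul_self hxyz.1.1 hxyz.1.2 hxyz.2.1]
    rw [show swap x y * swap y z * (swap y z * swap x y) = 1 by simp [mul_assoc]]
    exact altOp_one ρ
  rw [← Module.End.mul_apply]
  congr 1
  rw [mul_add, mul_add, hcube, mul_one]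
  abel

end AlternatingOperators

section SwapRelations

open Equiv Equiv.Perm

variable {Ω : Type*} [Fintype Ω] [DecidableEq Ω]

lemma exists_triple_sum_eq {M : Type*} [AddCommGroup M] (h2 : ∀ x : M, x + x = 0)
    (hcard : 9 ≤ Fintype.card Ω) (f : Ω → Ω → M) (hsymm : ∀ a b, f a b = f b a)
    (hf : ∀ a a' c c', [a, a', c, c'].Nodup → f a c + f a' c + f a c' + f a' c' = 0) :
    ∃ κ, ∀ a b c, [a, b, c].Nodup → f a b + f b c + f c a = κ := by
  have hstep : ∀ a b c d, [a, b, c, d].Nodup →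
      f a b + f b c + f c a = f b d + f d a + f a b := by
    intro a b c d h
    have h1 := hf a b c d h
    rw [hsymm a c, hsymm a d] at h1
    have h3 := h2 (f b d)
    have h4 := h2 (f d a)
    have h5 : f a b + f b c + f c a - (f b d + f d a + f a b) =
        (f c a + f b c + f d a + f b d) - (f b d + f b d) - (f d a + f d a) := by abel
    rw [h1, h3, h4] at h5
    simpa [sub_eq_zero] using h5
  have hdisj : ∀ a b c x y z, [a, b, c, x, y, z].Nodup →
      f a b + f b c + f c a = f x y + f y z + f z x := by
    intro a b c x y z h
    simp only [List.nodup_cons, List.mem_cons, List.not_mem_nil, or_false, not_or] at h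
    rw [hstep a b c x (by simp; grind), hstep b x a y (by simp; grind),
      hstep x y b z (by simp; grind)]
    abel
  obtain ⟨a, ha⟩ := exists_notMem_of_length_lt_card ([] : List Ω) (by simp; omega)
  obtain ⟨b, hb⟩ := exists_notMem_of_length_lt_card [a] (by simp; omega)
  obtain ⟨c, hc⟩ := exists_notMem_of_length_lt_card [a, b] (by simp; omega)
  refine ⟨f a b + f b c + f c a, fun x y z h => ?_⟩
  obtain ⟨p, hp⟩ := exists_notMem_of_length_lt_card [a, b, c, x, y, z] (by simp; omega)
  obtain ⟨q, hq⟩ := exists_notMem_of_length_lt_card [a, b, c, x, y, z, p] (by simp; omega)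
  obtain ⟨r, hr⟩ := exists_notMem_of_length_lt_card [a, b, c, x, y, z, p, q] (by simp; omega)
  simp only [List.nodup_cons, List.mem_cons, List.not_mem_nil, or_false, not_or] at *
  rw [hdisj x y z p q r (by simp; grind), hdisj a b c p q r (by simp; grind)]

/-- The permutation `a 0 ↦ a 1 ↦ a 2 ↦ a 0`. -/
lemma exists_rotation (a : Fin 3 → Ω) (ha : Function.Injective a) :
    ∃ g ∈ alternatingGroup Ω, (∀ i, g⁻¹ (a (i + 1)) = a i) ∧
      (∀ x, (∀ i, x ≠ a i) → g⁻¹ x = x) := by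
  have h01 : a 0 ≠ a 1 := ha.ne (by decide)
  have h02 : a 0 ≠ a 2 := ha.ne (by decide)
  have h12 : a 1 ≠ a 2 := ha.ne (by decide)
  refine ⟨swap (a 0) (a 1) * swap (a 1) (a 2), swap_mul_swap_mem_alternatingGroup h01 h12,
    ?_, ?_⟩
  · intro i
    rw [mul_inv_rev, swap_inv, swap_inv, Perm.mul_apply]
    fin_cases i
    · simp [swap_apply_def, h01, h02]
    · simp [swap_apply_def, h02.symm, h12.symm]
    · simp
  · intro x hx
    rw [mul_inv_rev, swap_inv, swap_inv, Perm.mul_apply, swap_apply_of_ne_of_ne (hx 0) (hx 1),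
      swap_apply_of_ne_of_ne (hx 1) (hx 2)]

variable {F M : Type*} [Field F] [CharP F 2] [AddCommGroup M] [Module F M]

lemma sum_swap_relation (hcard : 8 ≤ Fintype.card Ω) (T : Perm Ω → M) (φ : Perm Ω → F)
    (hφ : ∀ σ, ¬ σ.IsSwap → φ σ = 0)
    (hT : ∀ g ∈ alternatingGroup Ω, ∑ σ, φ σ • T (g * σ * g⁻¹) = 0)
    (a c a' c' : Fin 3 → Ω) (hac : [a 0, a 1, a 2, c 0, c 1, c 2].Nodup)
    (hac' : [a' 0, a' 1, a' 2, c' 0, c' 1, c' 2].Nodup) :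
    ∑ p : Fin 3 × Fin 3, (φ (swap (a p.1) (c p.2)) + φ (swap (a (p.1 - 1)) (c p.2)) +
      φ (swap (a p.1) (c (p.2 - 1))) + φ (swap (a (p.1 - 1)) (c (p.2 - 1)))) •
        T (swap (a' p.1) (c' p.2)) = 0 := by
  have haddself : ∀ x : F, x + x = 0 := CharTwo.add_self_eq_zero
  obtain ⟨k, hk, hkmap⟩ := exists_even_map_eq hac hac' (by simp) (by simpa using hcard)
  simp only [List.nodup_cons, List.mem_cons, List.not_mem_nil, or_false, not_or] at hac
  have ha : Function.Injective a := fun i j h => by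
    fin_cases i <;> fin_cases j <;> simp at h ⊢ <;> grind
  have hc : Function.Injective c := fun i j h => by
    fin_cases i <;> fin_cases j <;> simp at h ⊢ <;> grind
  have hne : ∀ i j, a i ≠ c j := fun i j h => by
    fin_cases i <;> fin_cases j <;> simp at h ⊢ <;> grind
  obtain ⟨g, hg, hga, hgx⟩ := exists_rotation a ha
  obtain ⟨h, hh, hhc, hhx⟩ := exists_rotation c hc
  have hka : ∀ i, k (a i) = a' i := by
    intro i
    simp at hkmap
    fin_cases i <;> simp [hkmap]
  have hkc : ∀ i, k (c i) = c' i := by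
    intro i
    simp at hkmap
    fin_cases i <;> simp [hkmap]
  have hconj : ∀ r ∈ alternatingGroup Ω,
      ∑ σ, φ (r⁻¹ * σ * r) • T (k * σ * k⁻¹) = 0 := by
    intro r hr
    rw [← hT (k * r) (mul_mem hk hr)]
    refine Fintype.sum_equiv (MulAut.conj r⁻¹).toEquiv _ _ fun σ => ?_
    simp [mul_assoc]
  have hswap : ∀ (r : Perm Ω) x y, r⁻¹ * swap x y * r = swap (r⁻¹ x) (r⁻¹ y) := by
    intro r x y
    rw [swap_apply_apply, inv_inv]
  have hsum : ∑ σ, (φ σ + φ (g⁻¹ * σ * g) + φ (h⁻¹ * σ * h) + φ ((g * h)⁻¹ * σ * (g * h))) •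
      T (k * σ * k⁻¹) = 0 := by
    have h1 := hconj 1 (one_mem _)
    simp only [inv_one, one_mul, mul_one] at h1
    simp only [add_smul, Finset.sum_add_distrib]
    rw [h1, hconj g hg, hconj h hh, hconj _ (mul_mem hg hh)]
    simp
  rw [← hsum]
  refine Finset.sum_of_injOn (fun p => swap (a p.1) (c p.2)) ?_ (by simp) ?_ ?_
  · rintro ⟨i, j⟩ - ⟨i', j'⟩ - hij
    have h1 := DFunLike.congr_fun (F := Perm Ω) hij (a i)
    simp only [swap_apply_left] at h1
    by_cases hi : i = i'
    · subst hi
      simp only [swap_apply_left] at h1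
      rw [hc h1]
    · rw [swap_apply_of_ne_of_ne (ha.ne hi) (hne _ _)] at h1
      exact absurd h1.symm (hne _ _)
  · intro σ _ hσ
    by_cases hs : σ.IsSwap
    · obtain ⟨x, y, hxy, rfl⟩ := hs
      have hgh : (g * h)⁻¹ * swap x y * (g * h) =
          swap (h⁻¹ (g⁻¹ x)) (h⁻¹ (g⁻¹ y)) := by
        rw [hswap, mul_inv_rev]; rfl
      rw [hgh, hswap, hswap]
      have key : φ (swap x y) + φ (swap (g⁻¹ x) (g⁻¹ y)) + φ (swap (h⁻¹ x) (h⁻¹ y)) +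
          φ (swap (h⁻¹ (g⁻¹ x)) (h⁻¹ (g⁻¹ y))) = 0 := by
        have hhfix : ∀ z, (∀ j, z ≠ c j) → h⁻¹ z = z ∧ h⁻¹ (g⁻¹ z) = g⁻¹ z := by
          intro z hz
          refine ⟨hhx z hz, ?_⟩
          by_cases hza : ∃ i, z = a i
          · obtain ⟨i, rfl⟩ := hza
            rw [← sub_add_cancel i 1, hga]
            exact hhx _ fun j => hne _ j
          · push Not at hza
            rw [hgx z hza, hhx z hz]
        by_cases hxc : ∃ j, x = c j
        · obtain ⟨j, rfl⟩ := hxc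
          by_cases hya : ∃ i, y = a i
          · obtain ⟨i, rfl⟩ := hya
            exact absurd ⟨(i, j), by simp, swap_comm _ _⟩ hσ
          · push Not at hya
            rw [hgx _ hya, hgx _ fun i => (hne i j).symm, haddself, zero_add, haddself]
        · push Not at hxc
          by_cases hyc : ∃ j, y = c j
          · obtain ⟨j, rfl⟩ := hyc
            by_cases hxa : ∃ i, x = a i
            · obtain ⟨i, rfl⟩ := hxa
              exact absurd ⟨(i, j), by simp, rfl⟩ hσ
            · push Not at hxa
              rw [hgx _ hxa, hgx _ fun i => (hne i j).symm, haddself, zero_add, haddself]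
          · push Not at hyc
            rw [(hhfix x hxc).1, (hhfix x hxc).2, (hhfix y hyc).1, (hhfix y hyc).2,
              add_right_comm (φ (swap x y)), haddself, zero_add, haddself]
      rw [key, zero_smul]
    · have hns : ∀ r : Perm Ω, φ (r⁻¹ * σ * r) = 0 := by
        intro r
        refine hφ _ fun ⟨x, y, hxy, h⟩ => hs ⟨r x, r y, r.injective.ne hxy, ?_⟩
        rw [swap_apply_apply, ← h]
        group
      rw [hφ σ hs, hns, hns, hns]
      simp
  · rintro ⟨i, j⟩ -
    have hgi : ∀ i, g⁻¹ (a i) = a (i - 1) := fun i => by rw [← hga (i - 1), sub_add_cancel]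
    have hhj : ∀ i, h⁻¹ (c i) = c (i - 1) := fun i => by rw [← hhc (i - 1), sub_add_cancel]
    have hgc : ∀ j, g⁻¹ (c j) = c j := fun j => hgx _ fun i => (hne i j).symm
    have hha : ∀ j, h⁻¹ (a j) = a j := fun j => hhx _ fun i => hne j i
    have hgh : (g * h)⁻¹ * swap (a i) (c j) * (g * h) =
          swap (h⁻¹ (g⁻¹ (a i))) (h⁻¹ (g⁻¹ (c j))) := by
        rw [hswap, mul_inv_rev]; rfl
    rw [hgh, hswap, hswap, hgi, hgc, hha, hha, hhj, ← swap_apply_apply, hka, hkc]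

lemma swap_relation_dichotomy (hcard : 8 ≤ Fintype.card Ω) (T : Perm Ω → M) (φ : Perm Ω → F)
    (hφ : ∀ σ, ¬ σ.IsSwap → φ σ = 0)
    (hT : ∀ g ∈ alternatingGroup Ω, ∑ σ, φ σ • T (g * σ * g⁻¹) = 0) :
    (∀ a a' c c', [a, a', c, c'].Nodup →
      φ (swap a c) + φ (swap a' c) + φ (swap a c') + φ (swap a' c') = 0) ∨
    (∀ a a' c c', [a, a', c, c'].Nodup →
      T (swap a c) + T (swap a' c) + T (swap a c') + T (swap a' c') = 0) := by
  have h2 : (2 : F) = 0 := CharTwo.two_eq_zero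
  rw [or_iff_not_imp_left]
  intro hD
  push Not at hD
  obtain ⟨x, x', y, y', hxy, hD⟩ := hD
  intro b b' d d' hbd
  obtain ⟨x₀, hx₀⟩ := exists_notMem_of_length_lt_card [x, x', y, y'] (by simp; omega)
  obtain ⟨y₀, hy₀⟩ := exists_notMem_of_length_lt_card [x, x', y, y', x₀] (by simp; omega)
  obtain ⟨b₀, hb₀⟩ := exists_notMem_of_length_lt_card [b, b', d, d'] (by simp; omega)
  obtain ⟨d₀, hd₀⟩ := exists_notMem_of_length_lt_card [b, b', d, d', b₀] (by simp; omega)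
  simp only [List.nodup_cons, List.mem_cons, List.not_mem_nil, or_false, not_or] at *
  have hrel := fun u v h => sum_swap_relation hcard T φ hφ hT ![x₀, x, x'] ![y₀, y, y'] u v
    (by simp; grind) h
  have r1 := hrel ![b, b', b₀] ![d, d', d₀] (by simp; grind)
  have r2 := hrel ![b', b, b₀] ![d, d', d₀] (by simp; grind)
  have r3 := hrel ![b, b', b₀] ![d', d, d₀] (by simp; grind)
  have r4 := hrel ![b', b, b₀] ![d', d, d₀] (by simp; grind)
  clear hrel
  have e1 : (0 : Fin 3) - 1 = 2 := by decide
  have e2 : (1 : Fin 3) - 1 = 0 := by decide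
  have e3 : (2 : Fin 3) - 1 = 1 := by decide
  simp only [Fintype.sum_prod_type, Fin.sum_univ_three, e1, e2, e3, Matrix.cons_val] at r1 r2 r3 r4
  set f00 := φ (swap x₀ y₀)
  set f01 := φ (swap x₀ y)
  set f02 := φ (swap x₀ y')
  set f10 := φ (swap x y₀)
  set f11 := φ (swap x y)
  set f12 := φ (swap x y')
  set f20 := φ (swap x' y₀)
  set f21 := φ (swap x' y)
  set f22 := φ (swap x' y')
  obtain ⟨ψ, hψ⟩ : ∃ ψ : Fin 3 → Fin 3 → F, ψ = fun i j =>
      ![![f00, f01, f02], ![f10, f11, f12], ![f20, f21, f22]] i j +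
      ![![f00, f01, f02], ![f10, f11, f12], ![f20, f21, f22]] (i - 1) j +
      ![![f00, f01, f02], ![f10, f11, f12], ![f20, f21, f22]] i (j - 1) +
      ![![f00, f01, f02], ![f10, f11, f12], ![f20, f21, f22]] (i - 1) (j - 1) := ⟨_, rfl⟩
  have hψD : ψ 0 0 + ψ 0 1 + ψ 1 0 + ψ 1 1 = f11 + f21 + f12 + f22 := by
    simp only [hψ, e1, e2, Matrix.cons_val]
    linear_combination ((f10 + f20) + (f01 + f02) + 2 * f00) * h2
  rw [← hψD] at hD
  have k1 : ∑ i, ∑ j, ψ i j • T (swap (![b, b', b₀] i) (![d, d', d₀] j)) = 0 := by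
    simpa only [Fin.sum_univ_three, hψ, e1, e2, e3, Matrix.cons_val] using r1
  have k2 : ∑ i, ∑ j, ψ i j • T (swap (![b', b, b₀] i) (![d, d', d₀] j)) = 0 := by
    simpa only [Fin.sum_univ_three, hψ, e1, e2, e3, Matrix.cons_val] using r2
  have k3 : ∑ i, ∑ j, ψ i j • T (swap (![b, b', b₀] i) (![d', d, d₀] j)) = 0 := by
    simpa only [Fin.sum_univ_three, hψ, e1, e2, e3, Matrix.cons_val] using r3
  have k4 : ∑ i, ∑ j, ψ i j • T (swap (![b', b, b₀] i) (![d', d, d₀] j)) = 0 := by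
    simpa only [Fin.sum_univ_three, hψ, e1, e2, e3, Matrix.cons_val] using r4
  clear r1 r2 r3 r4
  simp only [Fin.sum_univ_three, Matrix.cons_val] at k1 k2 k3 k4
  refine (smul_eq_zero_iff_right hD).mp ?_
  have z : ∀ u : M, (2 : F) • u = 0 := fun u => by rw [h2, zero_smul]
  linear_combination (norm := module) k1 + k2 + k3 + k4
    - ψ 2 0 • z (T (swap b₀ d) + T (swap b₀ d')) - ψ 2 1 • z (T (swap b₀ d) + T (swap b₀ d'))
    - (ψ 0 2 + ψ 1 2) • z (T (swap b d₀) + T (swap b' d₀)) - (2 * ψ 2 2) • z (T (swap b₀ d₀))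

end SwapRelations

section InvariantRelations

open Equiv Equiv.Perm

variable {Ω : Type*} [Fintype Ω] [DecidableEq Ω]
variable {F V : Type*} [Field F] [CharP F 2] [AddCommGroup V] [Module F V]
variable (ρ : Representation F (alternatingGroup Ω) V)
variable {X : Subgroup (Perm Ω)} {hX : X ≤ alternatingGroup Ω}

omit [CharP F 2] in
lemma altOp_mul_conj {τ g : Perm Ω} (hg : g ∈ alternatingGroup Ω) (σ : Perm Ω) :
    altOp ρ g * altOp ρ (σ * τ) = altOp ρ (g * σ * g⁻¹ * τ) * altOp ρ (τ⁻¹ * g * τ) := by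
  have hg' : τ⁻¹ * g * τ ∈ alternatingGroup Ω := by
    simpa using (alternatingGroup.normal (α := Ω)).conj_mem g hg τ⁻¹
  rw [← altOp_mul ρ hg, ← altOp_mul' ρ _ hg']
  congr 1
  group

omit [CharP F 2] in
lemma exists_invariant_relation [IsAlgClosed F]
    (hirr : RepIrreducible (ρ.comp (Subgroup.inclusion hX))) (τ : Perm Ω)
    (f₁ f₂ : Perm Ω → F) (h₁ : ∀ x ∈ X, ∀ σ, f₁ (x * σ * x⁻¹) = f₁ σ)
    (h₂ : ∀ x ∈ X, ∀ σ, f₂ (x * σ * x⁻¹) = f₂ σ) :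
    ∃ c₁ c₂ : F, (c₁ ≠ 0 ∨ c₂ ≠ 0) ∧ ∀ g ∈ alternatingGroup Ω,
      ∑ σ, (c₁ * f₁ σ + c₂ * f₂ σ) • altOp ρ (g * σ * g⁻¹ * τ) = 0 := by
  have := hirr.finiteDimensional
  have hnorm : ∀ g ∈ alternatingGroup Ω, τ⁻¹ * g * τ ∈ alternatingGroup Ω := fun g hg => by
    simpa using (alternatingGroup.normal (α := Ω)).conj_mem g hg τ⁻¹
  have hρ : ∀ g, (ρ.comp (Subgroup.inclusion hX)) g = altOp ρ g := fun g => by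
    rw [altOp_of_mem ρ (hX g.2)]
    rfl
  have hY : ∀ f : Perm Ω → F, (∀ x ∈ X, ∀ σ, f (x * σ * x⁻¹) = f σ) → ∀ x ∈ X,
      altOp ρ x * (∑ σ, f σ • altOp ρ (σ * τ)) =
        (∑ σ, f σ • altOp ρ (σ * τ)) * altOp ρ (τ⁻¹ * x * τ) := by
    intro f hf x hx
    rw [Finset.mul_sum, Finset.sum_mul]
    refine Fintype.sum_equiv (MulAut.conj x).toEquiv _ _ fun σ => ?_
    simp only [MulEquiv.toEquiv_eq_coe, EquivLike.coe_coe, MulAut.conj_apply]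
    rw [hf x hx, mul_smul_comm, smul_mul_assoc, altOp_mul_conj ρ (hX hx)]
  suffices ∃ c₁ c₂ : F, (c₁ ≠ 0 ∨ c₂ ≠ 0) ∧
      ∑ σ, (c₁ * f₁ σ + c₂ * f₂ σ) • altOp ρ (σ * τ) = 0 by
    obtain ⟨c₁, c₂, hc, hsum⟩ := this
    refine ⟨c₁, c₂, hc, fun g hg => ?_⟩
    have h3 : (∑ σ, (c₁ * f₁ σ + c₂ * f₂ σ) • altOp ρ (g * σ * g⁻¹ * τ)) *
        altOp ρ (τ⁻¹ * g * τ) = 0 := by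
      rw [← mul_zero (altOp ρ g), ← hsum, Finset.sum_mul, Finset.mul_sum]
      refine Finset.sum_congr rfl fun σ _ => ?_
      rw [mul_smul_comm, smul_mul_assoc, altOp_mul_conj ρ hg]
    have h4 := congrArg (· * altOp ρ (τ⁻¹ * g * τ)⁻¹) h3
    rwa [mul_assoc, altOp_mul_altOp_inv ρ (hnorm g hg), mul_one, zero_mul] at h4
  set Y₁ := ∑ σ, f₁ σ • altOp ρ (σ * τ) with hY₁
  set Y₂ := ∑ σ, f₂ σ • altOp ρ (σ * τ) with hY₂
  have hsum : ∀ c₁ c₂ : F, ∑ σ, (c₁ * f₁ σ + c₂ * f₂ σ) • altOp ρ (σ * τ) =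
      c₁ • Y₁ + c₂ • Y₂ := by
    intro c₁ c₂
    simp only [hY₁, hY₂, add_smul, mul_smul, Finset.sum_add_distrib, Finset.smul_sum]
  simp only [hsum]
  by_cases h0 : Y₁ = 0
  · exact ⟨1, 0, by simp, by simp [h0]⟩
  have hinv : RepInvariant (ρ.comp (Subgroup.inclusion hX)) (LinearMap.range Y₁) := by
    rintro g _ ⟨v, rfl⟩
    rw [hρ, ← Module.End.mul_apply, hY f₁ h₁ g g.2]
    exact ⟨_, rfl⟩
  have hsurj : LinearMap.range Y₁ = ⊤ := (hirr.2 _ hinv).resolve_left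
    (by rwa [LinearMap.range_eq_bot])
  have hunit : IsUnit Y₁ := (LinearMap.isUnit_iff_range_eq_top Y₁).mpr hsurj
  obtain ⟨Z, hYZ, hZY⟩ := isUnit_iff_exists.mp hunit
  obtain ⟨c, hc⟩ := hirr.exists_eq_smul_one (Y₂ * Z) (by
    intro g
    have k1 := hY f₁ h₁ g g.2
    have k2 := hY f₂ h₂ g g.2
    rw [← hY₁] at k1
    rw [← hY₂] at k2
    rw [hρ]
    have k3 : Z * altOp ρ (g : Perm Ω) = altOp ρ (τ⁻¹ * g * τ) * Z := by
      calc Z * altOp ρ (g : Perm Ω) = Z * (altOp ρ g * Y₁) * Z := by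
            rw [mul_assoc, mul_assoc, hYZ, mul_one]
        _ = altOp ρ (τ⁻¹ * g * τ) * Z := by rw [k1, ← mul_assoc, hZY, one_mul]
    rw [mul_assoc, k3, ← mul_assoc, ← mul_assoc, k2])
  refine ⟨-c, 1, by simp, ?_⟩
  have : Y₂ = c • Y₁ := by
    rw [← mul_one Y₂, ← hZY, ← mul_assoc, hc, smul_mul_assoc, one_mul]
  rw [this]
  simp

lemma three_cycle_sum_eq_zero_of_swap_relation
    (hirr : RepIrreducible (ρ.comp (Subgroup.inclusion hX))) (hV : 1 < Module.rank F V)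
    (hcard : 9 ≤ Fintype.card Ω) {τ : Perm Ω} (hτ : τ.IsSwap)
    (hT : ∀ a a' c c', [a, a', c, c'].Nodup → altOp ρ (swap a c * τ) + altOp ρ (swap a' c * τ) +
      altOp ρ (swap a c' * τ) + altOp ρ (swap a' c' * τ) = 0)
    {a b c : Ω} (habc : [a, b, c].Nodup) :
    1 + altOp ρ (swap a b * swap b c) +
      altOp ρ (swap a b * swap b c) * altOp ρ (swap a b * swap b c) = 0 := by
  have h2 : (2 : F) = 0 := CharTwo.two_eq_zero
  obtain ⟨s, hs⟩ := exists_triple_sum_eq (M := Module.End F V)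
    (fun x => by rw [← two_smul F, h2, zero_smul]) hcard
    (fun a b => altOp ρ (swap a b * τ)) (fun a b => by simp only [swap_comm]) hT
  refine three_cycle_sum_eq_zero_of_range_eq ρ hirr hV (LinearMap.range s) ?_ habc
  intro x y z hxyz
  have hs' := hs x y z hxyz
  simp only [List.nodup_cons, List.mem_cons, List.not_mem_nil, or_false, not_or] at hxyz
  have hmem := swap_mul_swap_mem_alternatingGroup (Ω := Ω) hxyz.1.1 hxyz.2.1
  obtain ⟨p, q, hpq, rfl⟩ := hτ
  have hτmem := swap_mul_swap_mem_alternatingGroup (Ω := Ω) hpq hxyz.2.1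
  have hE : 1 + altOp ρ (swap x y * swap y z) +
      altOp ρ (swap x y * swap y z) * altOp ρ (swap x y * swap y z) =
      s * altOp ρ (swap p q * swap y z) := by
    rw [← hs', add_mul, add_mul, ← altOp_mul' ρ _ hτmem, ← altOp_mul' ρ _ hτmem,
      ← altOp_mul' ρ _ hτmem, ← altOp_mul ρ hmem,
      swap_mul_swap_mul_self hxyz.1.1 hxyz.1.2 hxyz.2.1]
    have e : ∀ σ : Perm Ω, σ * swap p q * (swap p q * swap y z) = σ * swap y z := by
      intro σ
      rw [mul_assoc, swap_mul_self_mul]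
    have e2 : swap z x * swap y z = swap y z * swap x y := by
      ext w
      simp only [Perm.mul_apply, swap_apply_def]
      grind
    rw [e, e, e, swap_mul_self, altOp_one, e2]
    abel
  rw [hE, Module.End.mul_eq_comp, LinearMap.range_comp_of_range_eq_top]
  rw [LinearMap.range_eq_top]
  intro v
  exact ⟨altOp ρ (swap p q * swap y z)⁻¹ v,
    LinearMap.congr_fun (altOp_mul_altOp_inv ρ hτmem) v⟩

/-- If some `X`-invariant colouring of the pairs of points has three colours that occur as the
colour of the base of an isosceles triangle, then three-cycles satisfy `1 + c + c² = 0`. -/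
theorem three_cycle_sum_eq_zero_of_invariant [IsAlgClosed F]
    (hirr : RepIrreducible (ρ.comp (Subgroup.inclusion hX))) (hV : 1 < Module.rank F V)
    (hcard : 9 ≤ Fintype.card Ω) {ι : Type*} (inv : Ω → Ω → ι)
    (hsymm : ∀ x y, inv x y = inv y x) (hinv : ∀ g ∈ X, ∀ x y, inv (g x) (g y) = inv x y)
    (col : Fin 3 → ι) (hcol : Function.Injective col)
    (hiso : ∀ i, ∃ x y z, [x, y, z].Nodup ∧ inv x y = col i ∧ inv x z = inv y z)
    {a b c : Ω} (habc : [a, b, c].Nodup) :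
    1 + altOp ρ (swap a b * swap b c) +
      altOp ρ (swap a b * swap b c) * altOp ρ (swap a b * swap b c) = 0 := by
  classical
  let f : ι → Perm Ω → F := fun v σ =>
    if ∃ x y, x ≠ y ∧ σ = swap x y ∧ inv x y = v then 1 else 0
  have hf : ∀ v, ∀ x y, x ≠ y → f v (swap x y) = if inv x y = v then 1 else 0 := by
    intro v x y hxy
    have : (∃ x' y', x' ≠ y' ∧ swap x y = swap x' y' ∧ inv x' y' = v) ↔ inv x y = v := by
      refine ⟨?_, fun h => ⟨x, y, hxy, rfl, h⟩⟩
      rintro ⟨x', y', hxy', h, rfl⟩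
      have hx := DFunLike.congr_fun h x
      have hy := DFunLike.congr_fun h y
      simp only [swap_apply_left, swap_apply_right, swap_apply_def] at hx hy
      split_ifs at hx hy <;> grind
    simp only [f, this]
  have hfX : ∀ v, ∀ g ∈ X, ∀ σ, f v (g * σ * g⁻¹) = f v σ := by
    intro v g hg σ
    have : (∃ x y, x ≠ y ∧ g * σ * g⁻¹ = swap x y ∧ inv x y = v) ↔
        (∃ x y, x ≠ y ∧ σ = swap x y ∧ inv x y = v) := by
      constructor
      · rintro ⟨x, y, hxy, h, rfl⟩
        refine ⟨g⁻¹ x, g⁻¹ y, g⁻¹.injective.ne hxy, ?_, hinv _ (inv_mem hg) _ _⟩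
        rw [swap_apply_apply, ← h]
        group
      · rintro ⟨x, y, hxy, rfl, rfl⟩
        exact ⟨g x, g y, g.injective.ne hxy, (swap_apply_apply g x y).symm, hinv _ hg _ _⟩
    simp only [f, this]
  have habc' := habc
  simp only [List.nodup_cons, List.mem_cons, List.not_mem_nil, or_false, not_or] at habc'
  obtain ⟨c₁, c₂, hne, hrel⟩ := exists_invariant_relation ρ hirr (swap a b) (f (col 1)) (f (col 2))
    (hfX _) (hfX _)
  rcases swap_relation_dichotomy (by omega) (fun σ => altOp ρ (σ * swap a b))
    (fun σ => c₁ * f (col 1) σ + c₂ * f (col 2) σ) (by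
      intro σ hσ
      have : ∀ v, f v σ = 0 := fun v =>
        if_neg fun ⟨x, y, hxy, h, _⟩ => hσ ⟨x, y, hxy, h⟩
      simp [this]) hrel with h | h
  · exfalso
    obtain ⟨κ, hκ⟩ := exists_triple_sum_eq (fun x : F => CharTwo.add_self_eq_zero x) hcard
      (fun a b => c₁ * f (col 1) (swap a b) + c₂ * f (col 2) (swap a b))
      (fun a b => by simp only [swap_comm]) h
    have hval : ∀ i, c₁ * (if col i = col 1 then 1 else 0) +
        c₂ * (if col i = col 2 then 1 else 0) = κ := by
      intro i
      obtain ⟨x, y, z, hn, hxy, hz⟩ := hiso i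
      rw [← hκ x y z hn]
      simp only [List.nodup_cons, List.mem_cons, List.not_mem_nil, or_false, not_or] at hn
      rw [hf _ _ _ hn.1.1, hf _ _ _ hn.1.1, hf _ _ _ hn.2.1, hf _ _ _ hn.2.1,
        hf _ _ _ (Ne.symm hn.1.2), hf _ _ _ (Ne.symm hn.1.2), hxy, hsymm z x, hz, add_assoc,
        CharTwo.add_self_eq_zero, add_zero]
    have v0 := hval 0
    have v1 := hval 1
    have v2 := hval 2
    rw [if_neg (hcol.ne (by decide)), if_neg (hcol.ne (by decide))] at v0
    rw [if_pos rfl, if_neg (hcol.ne (by decide))] at v1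
    rw [if_neg (hcol.ne (by decide)), if_pos rfl] at v2
    simp only [mul_zero, mul_one, add_zero, zero_add] at v0 v1 v2
    rw [v1, v2, ← v0] at hne
    simp at hne
  · exact three_cycle_sum_eq_zero_of_swap_relation ρ hirr hV hcard ⟨a, b, habc'.1.1, rfl⟩ h habc

end InvariantRelations

section ThreeCycleRelations

open Equiv Equiv.Perm

variable {Ω : Type*} [Fintype Ω] [DecidableEq Ω]

/-- If the quantities `f x y z` are unchanged under permutations of the arguments and satisfy the
four term relation, then `f x y z + f x' y z` does not depend on `y` and `z`. -/
lemma exists_difference_function {M : Type*} [AddCommGroup M] (h2 : ∀ x : M, x + x = 0)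
    (hcard : 8 ≤ Fintype.card Ω) (f : Ω → Ω → Ω → M)
    (hf : ∀ a b c, [a, b, c].Nodup → f b a c = f a b c ∧ f b c a = f a b c)
    (hrel : ∀ x x' y y' z, [x, x', y, y', z].Nodup →
      f x y z + f x' y z + f x y' z + f x' y' z = 0) :
    ∃ d : Ω → Ω → M, ∀ x x' y z, [x, x', y, z].Nodup → d x x' = f x y z + f x' y z := by
  classical
  have hstep : ∀ x x' y y' z, [x, x', y, y', z].Nodup →
      f x y z + f x' y z = f x y' z + f x' y' z := by
    intro x x' y y' z h
    have h1 := hrel x x' y y' z h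
    have h3 := h2 (f x y' z + f x' y' z)
    rw [← sub_eq_zero, ← h1, sub_eq_iff_eq_add]
    calc f x y z + f x' y z = f x y z + f x' y z + 0 := by rw [add_zero]
      _ = _ := by rw [← h3]; abel
  have hindep : ∀ x x' y z y' z', [x, x', y, z].Nodup → [x, x', y', z'].Nodup →
      f x y z + f x' y z = f x y' z' + f x' y' z' := by
    intro x x' y z y' z' h h'
    obtain ⟨p, hp⟩ := exists_notMem_of_length_lt_card [x, x', y, z, y', z'] (by simp; omega)
    obtain ⟨q, hq⟩ := exists_notMem_of_length_lt_card [x, x', y, z, y', z', p] (by simp; omega)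
    have key : ∀ u v, [x, x', u, v].Nodup → p ∉ [x, x', u, v] → q ∉ [x, x', u, v] →
        f x u v + f x' u v = f x q p + f x' q p := by
      intro u v huv hpu hqu
      have hpq : p ≠ q := fun h => hq (by simp [h])
      have hswap : ∀ w, w ∉ [u, v, p, q] → f w p v = f w v p := by
        intro w hw
        have e1 := (hf w p v (by clear * - huv hpu hqu hpq hw; grind)).2
        have e2 := (hf p v w (by clear * - huv hpu hqu hpq hw; grind)).1
        have e3 := (hf w v p (by clear * - huv hpu hqu hpq hw; grind)).2
        grind
      rw [hstep x x' u p v (by clear * - huv hpu hqu hpq; grind), hswap x (by clear * - huv hpu hqu hpq; grind), hswap x' (by clear * - huv hpu hqu hpq; grind),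
        hstep x x' v q p (by clear * - huv hpu hqu hpq; grind)]
    simp only [List.mem_cons, List.not_mem_nil, or_false, not_or] at hp hq
    rw [key y z h (by simp; tauto) (by simp; tauto),
      key y' z' h' (by simp; tauto) (by simp; tauto)]
  refine ⟨fun x x' => if h : ∃ y z, [x, x', y, z].Nodup then
    f x h.choose h.choose_spec.choose + f x' h.choose h.choose_spec.choose else 0,
    fun x x' y z hn => ?_⟩
  have h : ∃ y z, [x, x', y, z].Nodup := ⟨y, z, hn⟩
  simp only [dif_pos h]
  exact hindep _ _ _ _ _ _ h.choose_spec.choose_spec hn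

variable {F V : Type*} [Field F] [CharP F 2] [AddCommGroup V] [Module F V]
variable (ρ : Representation F (alternatingGroup Ω) V)
variable {X : Subgroup (Perm Ω)} {hX : X ≤ alternatingGroup Ω}

/-- The sum of the operators of the subgroup generated by the three-cycle on `a, b, c`. -/
noncomputable def tripleSum (a b c : Ω) : Module.End F V :=
  1 + altOp ρ (swap a b * swap b c) + altOp ρ (swap b c * swap a b)

omit [CharP F 2] in
lemma tripleSum_eq {a b c : Ω} (h : [a, b, c].Nodup) :
    tripleSum ρ a b c = 1 + altOp ρ (swap a b * swap b c) +
      altOp ρ (swap a b * swap b c) * altOp ρ (swap a b * swap b c) := by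
  simp only [List.nodup_cons, List.mem_cons, List.not_mem_nil, or_false, not_or] at h
  rw [← altOp_mul ρ (swap_mul_swap_mem_alternatingGroup h.1.1 h.2.1),
    swap_mul_swap_mul_self h.1.1 h.1.2 h.2.1, tripleSum]

omit [CharP F 2] in
lemma tripleSum_symm {a b c : Ω} (h : [a, b, c].Nodup) :
    tripleSum ρ b a c = tripleSum ρ a b c ∧ tripleSum ρ b c a = tripleSum ρ a b c := by
  have e1 : swap b a * swap a c = swap b c * swap a b := by
    ext w; simp only [Perm.mul_apply, swap_apply_def]; grind
  have e2 : swap a c * swap b a = swap a b * swap b c := by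
    ext w; simp only [Perm.mul_apply, swap_apply_def]; grind
  have e3 : swap b c * swap c a = swap a b * swap b c := by
    ext w; simp only [Perm.mul_apply, swap_apply_def]; grind
  have e4 : swap c a * swap b c = swap b c * swap a b := by
    ext w; simp only [Perm.mul_apply, swap_apply_def]; grind
  simp only [tripleSum, e1, e2, e3, e4, and_true]
  abel

omit [CharP F 2] in
lemma altOp_mul_tripleSum {g : Perm Ω} (hg : g ∈ alternatingGroup Ω) (a b c : Ω) :
    altOp ρ g * tripleSum ρ a b c = tripleSum ρ (g a) (g b) (g c) * altOp ρ g := by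
  simp only [tripleSum, mul_add, add_mul, mul_one, one_mul]
  rw [← altOp_mul ρ hg, ← altOp_mul ρ hg, ← altOp_mul' ρ _ hg, ← altOp_mul' ρ _ hg]
  simp only [swap_apply_apply, mul_assoc, inv_mul_cancel_left, inv_mul_cancel, mul_one]

omit [CharP F 2] in
lemma tripleSum_commute {a b c x y z : Ω} (h : [a, b, c, x, y, z].Nodup) :
    tripleSum ρ a b c * tripleSum ρ x y z = tripleSum ρ x y z * tripleSum ρ a b c := by
  have h1 := altOp_mul_tripleSum ρ
    (swap_mul_swap_mem_alternatingGroup (a := a) (b := b) (c := b) (d := c) (by grind) (by grind))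
    x y z
  have h2 := altOp_mul_tripleSum ρ
    (swap_mul_swap_mem_alternatingGroup (a := b) (b := c) (c := a) (d := b) (by grind) (by grind))
    x y z
  have e : ∀ w, w ∉ [a, b, c] → (swap a b * swap b c) w = w ∧ (swap b c * swap a b) w = w := by
    intro w hw
    simp only [Perm.mul_apply, swap_apply_def]; grind
  rw [(e x (by grind)).1, (e y (by grind)).1, (e z (by grind)).1] at h1
  rw [(e x (by grind)).2, (e y (by grind)).2, (e z (by grind)).2] at h2
  rw [tripleSum, add_mul, add_mul, h1, h2, mul_add, mul_add, one_mul, mul_one]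

omit [CharP F 2] in
lemma altOp_mul_tripleSum_self {a b c : Ω} (h : [a, b, c].Nodup) :
    altOp ρ (swap a b * swap b c) * tripleSum ρ a b c = tripleSum ρ a b c := by
  have hmem := swap_mul_swap_mem_alternatingGroup (Ω := Ω) (a := a) (b := b) (c := b) (d := c)
    (by grind) (by grind)
  have e1 := swap_mul_swap_mul_self (a := a) (b := b) (c := c) (by grind) (by grind) (by grind)
  have e2 : swap a b * swap b c * (swap b c * swap a b) = 1 := by simp [mul_assoc]
  rw [tripleSum, mul_add, mul_add, ← altOp_mul ρ hmem, ← altOp_mul ρ hmem, e1, e2, altOp_one]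
  rw [mul_one]
  abel

lemma tripleSum_mul_self {a b c : Ω} (h : [a, b, c].Nodup) :
    tripleSum ρ a b c * tripleSum ρ a b c = tripleSum ρ a b c := by
  have e1 := altOp_mul_tripleSum_self ρ h
  have e2 : altOp ρ (swap b c * swap a b) * tripleSum ρ a b c = tripleSum ρ a b c := by
    rw [← swap_mul_swap_mul_self (a := a) (b := b) (c := c) (by clear * - h; grind) (by clear * - h; grind) (by clear * - h; grind),
      altOp_mul ρ (swap_mul_swap_mem_alternatingGroup (by clear * - h; grind) (by clear * - h; grind)), mul_assoc, e1, e1]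
  conv_lhs => enter [1]; rw [tripleSum]
  rw [add_mul, add_mul, e1, e2, one_mul, add_assoc, ← two_smul F, CharTwo.two_eq_zero, zero_smul,
    add_zero]

theorem tripleSum_eq_zero_of_relation
    (hirr : RepIrreducible (ρ.comp (Subgroup.inclusion hX))) (hV : 1 < Module.rank F V)
    (hcard : 9 ≤ Fintype.card Ω)
    (hrel : ∀ x x' y y' z, [x, x', y, y', z].Nodup → tripleSum ρ x y z + tripleSum ρ x' y z +
      tripleSum ρ x y' z + tripleSum ρ x' y' z = 0)
    {a b c : Ω} (habc : [a, b, c].Nodup) : tripleSum ρ a b c = 0 := by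
  set E := tripleSum ρ with hE
  have h2 : ∀ x : Module.End F V, x + x = 0 := fun x => by
    rw [← two_smul F, CharTwo.two_eq_zero, zero_smul]
  have heq : ∀ x y : Module.End F V, x + y = 0 → x = y := fun x y h => by
    rw [eq_neg_of_add_eq_zero_left h, neg_eq_iff_add_eq_zero, h2]
  have hEs : ∀ a b c, [a, b, c].Nodup → E b a c = E a b c ∧ E b c a = E a b c :=
    fun a b c h => tripleSum_symm ρ h
  have hEE : ∀ a b c, [a, b, c].Nodup → E a b c * E a b c = E a b c :=
    fun a b c h => tripleSum_mul_self ρ h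
  have hfresh : ∀ l : List Ω, l.length ≤ 8 → ∃ x, x ∉ l := fun l hl =>
    exists_notMem_of_length_lt_card l (by omega)
  obtain ⟨d, hd⟩ := exists_difference_function h2 (by omega) E hEs hrel
  have hd_symm : ∀ x y, x ≠ y → d x y = d y x := by
    intro x y hxy
    obtain ⟨p, hp⟩ := hfresh [x, y] (by simp)
    obtain ⟨q, hq⟩ := hfresh [x, y, p] (by simp)
    rw [hd x y p q (by clear * - hxy hp hq; grind), hd y x p q (by clear * - hxy hp hq; grind), add_comm]
  have hd_add : ∀ x y z, [x, y, z].Nodup → d x y = d x z + d z y := by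
    intro x y z h
    obtain ⟨p, hp⟩ := hfresh [x, y, z] (by simp)
    obtain ⟨q, hq⟩ := hfresh [x, y, z, p] (by simp)
    rw [hd x y p q (by clear * - h hp hq; grind), hd x z p q (by clear * - h hp hq; grind), hd z y p q (by clear * - h hp hq; grind)]
    have := h2 (E z p q)
    calc _ = E x p q + E y p q + 0 := by rw [add_zero]
      _ = _ := by rw [← this]; abel
  have hd_conj : ∀ g ∈ alternatingGroup Ω, ∀ x y, x ≠ y →
      altOp ρ g * d x y = d (g x) (g y) * altOp ρ g := by
    intro g hg x y hxy
    obtain ⟨p, hp⟩ := hfresh [x, y] (by simp)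
    obtain ⟨q, hq⟩ := hfresh [x, y, p] (by simp)
    rw [hd x y p q (by clear * - hxy hp hq; grind), hd (g x) (g y) (g p) (g q) (by
      have : [x, y, p, q].Nodup := by clear * - hxy hp hq; grind
      exact this.map g.injective), mul_add, add_mul,
      altOp_mul_tripleSum ρ hg, altOp_mul_tripleSum ρ hg]
  have hEcomm : ∀ a b c x y z, [a, b, c, x, y, z].Nodup →
      E a b c * E x y z = E x y z * E a b c := fun a b c x y z h => tripleSum_commute ρ h
  have hd_comm : ∀ a b c x y, [a, b, c, x, y].Nodup → E a b c * d x y = d x y * E a b c := by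
    intro a b c x y h
    obtain ⟨p, hp⟩ := hfresh [a, b, c, x, y] (by simp)
    obtain ⟨q, hq⟩ := hfresh [a, b, c, x, y, p] (by simp)
    rw [hd x y p q (by clear * - h hp hq; grind), mul_add, add_mul,
      hEcomm a b c x p q (by clear * - h hp hq; grind),
      hEcomm a b c y p q (by clear * - h hp hq; grind)]
  have hdd_comm : ∀ a b x y, [a, b, x, y].Nodup → d a b * d x y = d x y * d a b := by
    intro a b x y h
    obtain ⟨p, hp⟩ := hfresh [a, b, x, y] (by simp)
    obtain ⟨q, hq⟩ := hfresh [a, b, x, y, p] (by simp)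
    rw [hd a b p q (by clear * - h hp hq; grind), mul_add, add_mul, hd_comm a p q x y (by clear * - h hp hq; grind),
      hd_comm b p q x y (by clear * - h hp hq; grind)]
  let K : Ω → Ω → Ω → Ω → Module.End F V := fun a b c x => E a b c * d c x + d c x * E a b c
  have hKE : ∀ a b c x, [a, b, c, x].Nodup →
      K a b c x = E a b c * E a b x + E a b x * E a b c := by
    intro a b c x h
    have e5 : d c x = E a b c + E a b x := by
      rw [hd c x a b (by clear * - h; grind), ← (hEs c a b (by clear * - h; grind)).2,
        ← (hEs x a b (by clear * - h; grind)).2]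
    simp only [K]
    rw [e5, mul_add, add_mul]
    calc _ = (E a b c * E a b c + E a b c * E a b c) + (E a b c * E a b x + E a b x * E a b c) := by
          abel
      _ = _ := by rw [h2, zero_add]
  have hKab : ∀ a b c x, [a, b, c, x].Nodup → K b a c x = K a b c x := by
    intro a b c x h
    simp only [K]
    rw [(hEs a b c (by clear * - h; grind)).1]
  have hKcx : ∀ a b c x, [a, b, c, x].Nodup → K a b x c = K a b c x := by
    intro a b c x h
    rw [hKE a b c x h, hKE a b x c (by clear * - h; grind), add_comm]
  have hKa : ∀ a a' b c x, [a, a', b, c, x].Nodup → K a b c x = K a' b c x := by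
    intro a a' b c x h
    have e := hd a a' b c (by clear * - h; grind)
    have e1 : E a b c = d a a' + E a' b c := by
      rw [e, add_assoc, h2, add_zero]
    have e2 := hdd_comm a a' c x (by clear * - h; grind)
    simp only [K]
    rw [e1, mul_add, add_mul, e2]
    calc _ = (d c x * d a a' + d c x * d a a') + (E a' b c * d c x + d c x * E a' b c) := by
          abel
      _ = _ := by rw [h2, zero_add]
  have hKx : ∀ a b c x y, [a, b, c, x, y].Nodup → K a b c x = K a b c y := by
    intro a b c x y h
    simp only [K]
    rw [hd_add c x y (by clear * - h; grind), mul_add, add_mul, hd_comm a b c y x (by clear * - h; grind)]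
    calc _ = (d y x * E a b c + d y x * E a b c) + (E a b c * d c y + d c y * E a b c) := by
          abel
      _ = _ := by rw [h2, zero_add]
  have hKdisj : ∀ a b c x u v p q, [a, b, c, x, u, v, p, q].Nodup → K a b c x = K u v p q := by
    intro a b c x u v p q h
    rw [hKa a u b c x (by clear * - h; grind), ← hKab u b c x (by clear * - h; grind), hKa b v u c x (by clear * - h; grind),
      hKab u v c x (by clear * - h; grind), hKx u v c x p (by clear * - h; grind), ← hKcx u v c p (by clear * - h; grind),
      hKx u v p c q (by clear * - h; grind)]
  have hK : ∀ a b c x, [a, b, c, x].Nodup → K a b c x = 0 := by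
    intro a b c x h
    obtain ⟨u, hu⟩ := hfresh [a, b, c, x] (by simp)
    obtain ⟨v, hv⟩ := hfresh [a, b, c, x, u] (by simp)
    obtain ⟨p, hp⟩ := hfresh [a, b, c, x, u, v] (by simp)
    obtain ⟨q, hq⟩ := hfresh [a, b, c, x, u, v, p] (by simp)
    have k1 := hKdisj a b c x u v p q (by clear * - h hu hv hp hq; grind)
    have k2 : E a b c * K a b c x = K a b c x * E a b c := by
      have c1 : E a b c * E u v p = E u v p * E a b c := tripleSum_commute ρ (by clear * - h hu hv hp hq; grind)
      have c2 : E a b c * E u v q = E u v q * E a b c := tripleSum_commute ρ (by clear * - h hu hv hp hq; grind)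
      rw [k1, hKE u v p q (by clear * - h hu hv hp hq; grind), mul_add, add_mul, ← mul_assoc, c1, mul_assoc, c2,
        ← mul_assoc, ← mul_assoc, c2, mul_assoc _ _ (E u v p), c1, ← mul_assoc]
    have k3 : K a b c x = E a b c * K a b c x + K a b c x * E a b c := by
      have e := hEE a b c (by clear * - h hu hv hp hq; grind)
      simp only [K]
      rw [mul_add, add_mul, ← mul_assoc, e, mul_assoc (d c x), e]
      calc _ = E a b c * d c x + d c x * E a b c + 0 := by rw [add_zero]
        _ = _ := by rw [← h2 (E a b c * d c x * E a b c)]; noncomm_ring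
    rw [k3, k2, h2]
  have hcomm : ∀ a b c x, [a, b, c, x].Nodup → E a b c * d c x = d c x * E a b c :=
    fun a b c x h => heq _ _ (hK a b c x h)
  have hcommE : ∀ a b c x, [a, b, c, x].Nodup → E a b c * E a b x = E a b x * E a b c :=
    fun a b c x h => heq _ _ ((hKE a b c x h).symm.trans (hK a b c x h))
  have hdcomm : ∀ a b c, [a, b, c].Nodup → d a b * d a c = d a c * d a b := by
    intro a b c h
    obtain ⟨p, hp⟩ := hfresh [a, b, c] (by simp)
    obtain ⟨q, hq⟩ := hfresh [a, b, c, p] (by simp)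
    have e1 := hcomm p q a c (by clear * - h hp hq; grind)
    have e2 := hEs a p q (by clear * - h hp hq; grind)
    rw [hd a b p q (by clear * - h hp hq; grind), mul_add, add_mul, hd_comm b p q a c (by clear * - h hp hq; grind), ← e2.2, e1]
  have hdd : ∀ c x, c ≠ x → d c x * d c x = d c x := by
    intro c x h
    obtain ⟨p, hp⟩ := hfresh [c, x] (by simp)
    obtain ⟨q, hq⟩ := hfresh [c, x, p] (by simp)
    have e1 := hcommE p q c x (by clear * - h hp hq; grind)
    rw [(hEs c p q (by clear * - h hp hq; grind)).2, (hEs x p q (by clear * - h hp hq; grind)).2] at e1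
    rw [hd c x p q (by clear * - h hp hq; grind), mul_add, add_mul, add_mul, hEE c p q (by clear * - h hp hq; grind),
      hEE x p q (by clear * - h hp hq; grind), e1]
    calc _ = (E x p q * E c p q + E x p q * E c p q) + (E c p q + E x p q) := by abel
      _ = _ := by rw [h2, zero_add]
  have hEd : ∀ a b c, [a, b, c].Nodup → E a b c * d a c = 0 := by
    intro a b c h
    obtain ⟨x, hx⟩ := hfresh [a, b, c] (by simp)
    have hmem := swap_mul_swap_mem_alternatingGroup (Ω := Ω) (a := a) (b := b) (c := b) (d := c)
      (by clear * - h hx; grind) (by clear * - h hx; grind)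
    have ha : (swap a b * swap b c) a = b := by
      clear * - h; simp only [Perm.mul_apply, swap_apply_def]; grind
    have hb : (swap a b * swap b c) b = c := by
      clear * - h; simp only [Perm.mul_apply, swap_apply_def]; grind
    have hc : (swap a b * swap b c) c = a := by
      clear * - h; simp only [Perm.mul_apply, swap_apply_def]; grind
    have hx' : (swap a b * swap b c) x = x := by
      clear * - h hx; simp only [Perm.mul_apply, swap_apply_def]; grind
    have e1 := altOp_mul_tripleSum ρ hmem a b x
    have e2 := altOp_mul_tripleSum_self ρ h
    have e3 := altOp_mul_tripleSum ρ hmem a b c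
    rw [ha, hb, hx', ← hE] at e1
    rw [ha, hb, hc, ← hE, (hEs a b c h).2] at e3
    rw [← hE] at e2
    have e5 : E a b c * E b c x = E a b c * E a b x := by
      have c1 := hcommE b c a x (by clear * - h hx; grind)
      rw [(hEs a b c h).2] at c1
      calc E a b c * E b c x = E b c x * (altOp ρ (swap a b * swap b c) * E a b c) := by
            rw [e2, c1]
        _ = E a b c * E b c x * altOp ρ (swap a b * swap b c) := by rw [e3, ← mul_assoc, c1]
        _ = E a b c * altOp ρ (swap a b * swap b c) * E a b x := by rw [mul_assoc, ← e1, mul_assoc]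
        _ = E a b c * E a b x := by rw [← e3, e2]
    rw [hd a c b x (by clear * - h hx; grind), mul_add, (hEs b c x (by clear * - h hx; grind)).1, e5, h2]
  have hprod : ∀ a b c, [a, b, c].Nodup → d a b * d a c = 0 := by
    intro a b c h
    have hmem := swap_mul_swap_mem_alternatingGroup (Ω := Ω) (a := a) (b := b) (c := b) (d := c)
      (by clear * - h; grind) (by clear * - h; grind)
    have hmem' := swap_mul_swap_mem_alternatingGroup (Ω := Ω) (a := b) (b := c) (c := a) (d := b)
      (by clear * - h; grind) (by clear * - h; grind)
    have ha : (swap a b * swap b c) a = b := by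
      clear * - h; simp only [Perm.mul_apply, swap_apply_def]; grind
    have hb : (swap a b * swap b c) b = c := by
      clear * - h; simp only [Perm.mul_apply, swap_apply_def]; grind
    have hc : (swap a b * swap b c) c = a := by
      clear * - h; simp only [Perm.mul_apply, swap_apply_def]; grind
    have ha' : (swap b c * swap a b) a = c := by
      clear * - h; simp only [Perm.mul_apply, swap_apply_def]; grind
    have hb' : (swap b c * swap a b) b = a := by
      clear * - h; simp only [Perm.mul_apply, swap_apply_def]; grind
    have hc' : (swap b c * swap a b) c = b := by
      clear * - h; simp only [Perm.mul_apply, swap_apply_def]; grind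
    have hab : a ≠ b := by clear * - h; grind
    have hac : a ≠ c := by clear * - h; grind
    have hbc : b ≠ c := by clear * - h; grind
    have hkill : d a b * d a c * d b c = 0 := by
      rw [hd_add b c a (by clear * - h; grind), mul_add, mul_assoc _ _ (d a c), hdd a c hac,
        hdcomm a b c h, ← hd_symm a b hab, mul_assoc, hdd a b hab, h2]
    have h0 : E a b c * (d a b * d a c) = 0 := by
      have : E a c b * d a b = 0 := hEd a c b (by clear * - h; grind)
      rw [← mul_assoc, show E a b c = E a c b by
        rw [← (hEs a c b (by clear * - h; grind)).1, ← (hEs c a b (by clear * - h; grind)).2], this, zero_mul]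
    have hfirst : d a b * d a c * (altOp ρ (swap a b * swap b c) * (d a b * d a c)) = 0 := by
      have e : altOp ρ (swap a b * swap b c) * (d a b * d a c) =
          d b c * (d b a * altOp ρ (swap a b * swap b c)) := by
        rw [← mul_assoc, hd_conj _ hmem a b hab, mul_assoc, hd_conj _ hmem a c hac, ha, hb, hc]
      rw [e, ← mul_assoc, hkill, zero_mul]
    have hsecond : d a b * d a c * (altOp ρ (swap b c * swap a b) * (d a b * d a c)) = 0 := by
      have e : altOp ρ (swap b c * swap a b) * (d a b * d a c) =
          d a c * (d b c * altOp ρ (swap b c * swap a b)) := by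
        rw [← mul_assoc, hd_conj _ hmem' a b hab, mul_assoc, hd_conj _ hmem' a c hac, ha', hb',
          hc', hd_symm c a hac.symm, hd_symm c b hbc.symm]
      rw [e, ← mul_assoc, mul_assoc (d a b) (d a c) (d a c), hdd a c hac, ← mul_assoc, hkill,
        zero_mul]
    have hsq : d a b * d a c * (d a b * d a c) = d a b * d a c := by
      rw [← mul_assoc, mul_assoc (d a b), ← hdcomm a b c h, ← mul_assoc, hdd a b hab, mul_assoc,
        hdd a c hac]
    have h3 := congrArg (d a b * d a c * ·) h0
    rw [mul_zero, hE, tripleSum] at h3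
    simp only [add_mul, mul_add, one_mul] at h3
    rwa [hfirst, hsecond, hsq, add_zero, add_zero] at h3
  have hd0 : ∀ a b, a ≠ b → d a b = 0 := by
    intro a b hab
    obtain ⟨c, hc⟩ := hfresh [a, b] (by simp)
    rw [← hdd a b hab, hd_add a b c (by clear * - hab hc; grind), mul_add, ← hd_add a b c (by clear * - hab hc; grind),
      hprod a b c (by clear * - hab hc; grind), hd_symm a b hab, hd_symm c b (by clear * - hab hc; grind), hprod b a c (by clear * - hab hc; grind),
      add_zero]
  have hconst1 : ∀ a a' b c, [a, a', b, c].Nodup → E a b c = E a' b c := by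
    intro a a' b c h
    exact heq _ _ ((hd a a' b c h).symm.trans (hd0 a a' (by clear * - h; grind)))
  have hconst : ∀ a b c x y z, [a, b, c, x, y, z].Nodup → E a b c = E x y z := by
    intro a b c x y z h
    rw [hconst1 a x b c (by clear * - h; grind), ← (hEs x b c (by clear * - h; grind)).2, hconst1 b y c x (by clear * - h; grind),
      ← (hEs y c x (by clear * - h; grind)).2, hconst1 c z x y (by clear * - h; grind), ← (hEs z x y (by clear * - h; grind)).2]
  rw [hE, tripleSum_eq ρ habc]
  refine three_cycle_sum_eq_zero_of_range_eq ρ hirr hV (LinearMap.range (E a b c)) ?_ habc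
  intro x y z hxyz
  obtain ⟨u, hu⟩ := hfresh [a, b, c, x, y, z] (by simp)
  obtain ⟨v, hv⟩ := hfresh [a, b, c, x, y, z, u] (by simp)
  obtain ⟨w, hw⟩ := hfresh [a, b, c, x, y, z, u, v] (by simp)
  rw [← tripleSum_eq ρ hxyz, ← hE, hconst x y z u v w (by clear * - habc hxyz hu hv hw; grind), hconst a b c u v w (by clear * - habc hxyz hu hv hw; grind)]

end ThreeCycleRelations
section DimensionBound

variable {F V : Type*} [Field F] [CharP F 2] [AddCommGroup V] [Module F V] [FiniteDimensional F V]

lemma two_pow_card_le_finrank_of_inverted {ι : Type*} {ω : F} (hω : ω ^ 2 = ω + 1)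
    (c g : ι → Module.End F V)
    (hc : ∀ i, 1 + c i + c i * c i = 0)
    (hcc : ∀ i j, i ≠ j → c i * c j = c j * c i)
    (hg : ∀ i, g i * g i = 1) (hcg : ∀ i, c i * g i = g i * (c i * c i))
    (hgc : ∀ i j, i ≠ j → c i * g j = g j * c i) (s : Finset ι) :
    ∀ W : Submodule F V, W ≠ ⊥ → (∀ i ∈ s, ∀ w ∈ W, c i w ∈ W) → (∀ i ∈ s, ∀ w ∈ W, g i w ∈ W) →
      2 ^ s.card ≤ Module.finrank F W := by
  classical
  have h2 : (2 : F) = 0 := CharTwo.two_eq_zero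
  induction s using Finset.induction_on with
  | empty =>
    intro W hW _ _
    have := Submodule.one_le_finrank_iff.mpr hW
    simpa using this
  | insert i s his ih =>
    intro W hW hcW hgW
    have hgg : ∀ v, g i (g i v) = v := fun v => LinearMap.congr_fun (hg i) v
    have hinj : Function.Injective (g i) := fun x y hxy => by
      rw [← hgg x, hxy, hgg]
    have hcgv : ∀ v, c i (g i v) = g i (c i (c i v)) := fun v => LinearMap.congr_fun (hcg i) v
    have hcv : ∀ v, v + c i v + c i (c i v) = 0 := fun v => LinearMap.congr_fun (hc i) v
    let W' : Submodule F V := W ⊓ (c i).eigenspace ω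
    have memW' : ∀ v, v ∈ W' ↔ v ∈ W ∧ c i v = ω • v := fun v => by
      simp [W']
    have hW' : W' ≠ ⊥ := by
      obtain ⟨w, hw, hw0⟩ := (Submodule.ne_bot_iff W).mp hW
      rw [Submodule.ne_bot_iff]
      by_cases h0 : c i w + (ω + 1) • w = 0
      · have hcw : c i w = (ω + 1) • w := by
          rw [eq_neg_of_add_eq_zero_left h0, ← neg_smul]
          congr 1
          linear_combination (-ω - 1) * h2
        refine ⟨g i w, (memW' _).mpr ⟨hgW i (Finset.mem_insert_self _ _) w hw, ?_⟩, ?_⟩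
        · rw [hcgv, hcw, map_smul, hcw, smul_smul, map_smul]
          congr 1
          linear_combination hω + (ω + 1) * h2
        · intro h
          exact hw0 (hinj (by rw [h, map_zero]))
      · refine ⟨_, (memW' _).mpr ⟨W.add_mem (hcW i (Finset.mem_insert_self _ _) w hw)
          (W.smul_mem _ hw), ?_⟩, h0⟩
        rw [map_add, map_smul, eq_neg_of_add_eq_zero_right (hcv w), smul_add, smul_smul]
        have : ω * (ω + 1) = 1 + 2 * ω := by linear_combination hω
        have h2w : (2 : F) • w = 0 := by rw [h2, zero_smul]
        rw [this, h2]
        linear_combination (norm := module) (-1 : F) • h2w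
    have hdisj : Disjoint W' (W'.map (g i)) := by
      rw [Submodule.disjoint_def]
      rintro x hx ⟨y, hy, rfl⟩
      have h1 := ((memW' _).mp hx).2
      rw [hcgv, ((memW' _).mp hy).2, map_smul, ((memW' _).mp hy).2, smul_smul, map_smul] at h1
      have h3 : (ω * ω - ω) • g i y = 0 := by rw [sub_smul, h1, sub_self]
      rwa [show ω * ω - ω = 1 by linear_combination hω, one_smul] at h3
    have hle : W' ⊔ W'.map (g i) ≤ W := by
      refine sup_le inf_le_left ?_
      rintro _ ⟨y, hy, rfl⟩
      exact hgW i (Finset.mem_insert_self _ _) y hy.1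
    have hsum := Submodule.finrank_sup_add_finrank_inf_eq W' (W'.map (g i))
    rw [hdisj.eq_bot, finrank_bot,
      ← (Submodule.equivMapOfInjective (g i) hinj W').finrank_eq] at hsum
    have hrec : 2 ^ s.card ≤ Module.finrank F W' := by
      refine ih W' hW' ?_ ?_
      · intro j hj w hw
        have hij : i ≠ j := fun h => his (h ▸ hj)
        obtain ⟨hw1, hw2⟩ := (memW' w).mp hw
        refine (memW' _).mpr ⟨hcW j (Finset.mem_insert_of_mem hj) w hw1, ?_⟩
        have := LinearMap.congr_fun (hcc i j hij) w
        simp only [Module.End.mul_apply] at this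
        rw [this, hw2, map_smul]
      · intro j hj w hw
        have hij : i ≠ j := fun h => his (h ▸ hj)
        obtain ⟨hw1, hw2⟩ := (memW' w).mp hw
        refine (memW' _).mpr ⟨hgW j (Finset.mem_insert_of_mem hj) w hw1, ?_⟩
        have := LinearMap.congr_fun (hgc i j hij) w
        simp only [Module.End.mul_apply] at this
        rw [this, hw2, map_smul]
    have := Submodule.finrank_mono hle
    rw [Finset.card_insert_of_notMem his, pow_succ]
    omega

end DimensionBound

section TransportOfClassSums

open Equiv Equiv.Perm

variable {Ω : Type*} [Fintype Ω] [DecidableEq Ω]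
variable {F V : Type*} [Field F] [CharP F 2] [AddCommGroup V] [Module F V]
variable (ρ : Representation F (alternatingGroup Ω) V)
variable {X : Subgroup (Perm Ω)} {hX : X ≤ alternatingGroup Ω}

omit [CharP F 2] in
lemma altOp_conj {k : Perm Ω} (hk : k ∈ alternatingGroup Ω) (σ : Perm Ω) :
    altOp ρ (k * σ * k⁻¹) = altOp ρ k * altOp ρ σ * altOp ρ k⁻¹ := by
  rw [altOp_mul' ρ _ (inv_mem hk), altOp_mul ρ hk]

omit [CharP F 2] in
lemma exists_sum_altOp_conj_eq [IsAlgClosed F]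
    (hirr : RepIrreducible (ρ.comp (Subgroup.inclusion hX))) (S : Finset (Perm Ω))
    (hS : ∀ g ∈ X, ∀ σ ∈ S, g * σ * g⁻¹ ∈ S) :
    ∃ C : Module.End F V, ∀ k ∈ alternatingGroup Ω, ∑ σ ∈ S, altOp ρ (k * σ * k⁻¹) = C := by
  have hsum : ∀ k ∈ alternatingGroup Ω, ∑ σ ∈ S, altOp ρ (k * σ * k⁻¹) =
      altOp ρ k * (∑ σ ∈ S, altOp ρ σ) * altOp ρ k⁻¹ := by
    intro k hk
    rw [Finset.mul_sum, Finset.sum_mul]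
    exact Finset.sum_congr rfl fun σ _ => altOp_conj ρ hk σ
  obtain ⟨c, hc⟩ := hirr.exists_eq_smul_one (∑ σ ∈ S, altOp ρ σ) (by
    intro g
    have hg := hX g.2
    have e : (ρ.comp (Subgroup.inclusion hX)) g = altOp ρ (g : Perm Ω) :=
      (altOp_of_mem ρ hg).symm
    have e2 : ∑ σ ∈ S, altOp ρ (g * σ * (g : Perm Ω)⁻¹) = ∑ σ ∈ S, altOp ρ σ := by
      refine Finset.sum_bij' (fun σ _ => g * σ * (g : Perm Ω)⁻¹)
        (fun σ _ => (g : Perm Ω)⁻¹ * σ * g) (fun σ hσ => hS g g.2 σ hσ)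
        (fun σ hσ => by simpa using hS _ (inv_mem g.2) σ hσ) ?_ ?_ ?_
      · intro σ _; group
      · intro σ _; group
      · intro σ _; rfl
    rw [e]
    conv_lhs => rw [← e2, hsum _ hg, mul_assoc, altOp_inv_mul_altOp ρ hg, mul_one])
  refine ⟨c • 1, fun k hk => ?_⟩
  rw [hsum k hk, hc, mul_smul_comm, mul_one, smul_mul_assoc, altOp_mul_altOp_inv ρ hk]

/-- If an `X`-invariant set of permutations contains a three-cycle and its inverse, and each of its
other members fixes three points of one of two suitable triples, then the three-cycles satisfy
`1 + c + c * c = 0` as operators. -/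
theorem tripleSum_eq_zero_of_invariant_set [IsAlgClosed F]
    (hirr : RepIrreducible (ρ.comp (Subgroup.inclusion hX))) (hV : 1 < Module.rank F V)
    (hcard : 9 ≤ Fintype.card Ω) (S : Finset (Perm Ω))
    (hS : ∀ g ∈ X, ∀ σ ∈ S, g * σ * g⁻¹ ∈ S) {x x' x'' y y' y'' z : Ω}
    (hnd : [x, x', x'', y, y', y'', z].Nodup)
    (hmem : swap x y * swap y z ∈ S) (hmem' : swap y z * swap x y ∈ S)
    (hfix : ∀ σ ∈ S, σ = swap x y * swap y z ∨ σ = swap y z * swap x y ∨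
      (σ x = x ∧ σ x' = x' ∧ σ x'' = x'') ∨ (σ y = y ∧ σ y' = y' ∧ σ y'' = y''))
    {a b c : Ω} (habc : [a, b, c].Nodup) : tripleSum ρ a b c = 0 := by
  have h2 : ∀ x : Module.End F V, x + x = 0 := fun x => by
    rw [← two_smul F, CharTwo.two_eq_zero, zero_smul]
  have hd := hnd
  simp only [List.nodup_cons, List.mem_cons, List.not_mem_nil, or_false, not_or] at hd
  obtain ⟨C, hC⟩ := exists_sum_altOp_conj_eq ρ hirr S hS
  set c₁ := swap x y * swap y z with hc₁
  set c₂ := swap y z * swap x y with hc₂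
  have hne : c₁ ≠ c₂ := by
    intro h
    have := DFunLike.congr_fun h x
    clear * - this hd hc₁ hc₂
    simp only [hc₁, hc₂, Perm.mul_apply, swap_apply_def] at this
    grind
  let D : Perm Ω → Module.End F V := fun k => ∑ σ ∈ (S.erase c₁).erase c₂, altOp ρ (k * σ * k⁻¹)
  have hD : ∀ k ∈ alternatingGroup Ω, tripleSum ρ (k x) (k y) (k z) = 1 + C + D k := by
    intro k hk
    rw [← hC k hk, ← Finset.add_sum_erase S _ hmem,
      ← Finset.add_sum_erase _ _ (Finset.mem_erase.mpr ⟨hne.symm, hmem'⟩)]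
    have e : tripleSum ρ (k x) (k y) (k z) =
        1 + altOp ρ (k * c₁ * k⁻¹) + altOp ρ (k * c₂ * k⁻¹) := by
      simp only [tripleSum, swap_apply_apply, hc₁, hc₂, mul_assoc, inv_mul_cancel_left]
    rw [e]
    calc _ = 1 + altOp ρ (k * c₁ * k⁻¹) + altOp ρ (k * c₂ * k⁻¹) + (D k + D k) := by
          rw [h2, add_zero]
      _ = _ := by simp only [D]; abel
  set g := swap x x' * swap x' x'' with hg
  set h := swap y y' * swap y' y'' with hh
  have hgA : g ∈ alternatingGroup Ω :=
    swap_mul_swap_mem_alternatingGroup (by clear * - hd; grind) (by clear * - hd; grind)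
  have hhA : h ∈ alternatingGroup Ω :=
    swap_mul_swap_mem_alternatingGroup (by clear * - hd; grind) (by clear * - hd; grind)
  have hgx : g x = x' := by
    clear * - hd hg; simp only [hg, Perm.mul_apply, swap_apply_def]; grind
  have hgf : ∀ w, w ∉ [x, x', x''] → g w = w := by
    intro w hw; clear * - hg hw; simp only [hg, Perm.mul_apply, swap_apply_def]; grind
  have hhy : h y = y' := by
    clear * - hd hh; simp only [hh, Perm.mul_apply, swap_apply_def]; grind
  have hhf : ∀ w, w ∉ [y, y', y''] → h w = w := by
    intro w hw; clear * - hh hw; simp only [hh, Perm.mul_apply, swap_apply_def]; grind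
  have hcomm : ∀ {σ : Perm Ω} {p q r}, σ p = p → σ q = q → σ r = r →
      swap p q * swap q r * σ = σ * (swap p q * swap q r) := by
    intro σ p q r hp hq hr
    rw [← mul_assoc, mul_swap_eq_swap_mul σ p q, hp, hq, mul_assoc _ σ,
      mul_swap_eq_swap_mul σ q r, hq, hr, mul_assoc]
  have hconj : ∀ {g σ : Perm Ω} (k), g * σ = σ * g → k * g * σ * (k * g)⁻¹ = k * σ * k⁻¹ := by
    intro g σ k h
    rw [mul_assoc k, h]; group
  have hgh : g * h = h * g := by
    refine (hcomm (hgf y ?_) (hgf y' ?_) (hgf y'' ?_)).symm <;> (clear * - hd; grind)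
  have hDk : ∀ k, D k + D (k * g) + D (k * h) + D (k * g * h) = 0 := by
    intro k
    simp only [D, ← Finset.sum_add_distrib]
    refine Finset.sum_eq_zero fun σ hσ => ?_
    simp only [Finset.mem_erase] at hσ
    rcases hfix σ hσ.2.2 with h1 | h1 | ⟨h1, h3, h4⟩ | ⟨h1, h3, h4⟩
    · exact absurd h1 hσ.2.1
    · exact absurd h1 hσ.1
    · have e : g * σ = σ * g := hcomm h1 h3 h4
      rw [mul_assoc k g h, hgh, ← mul_assoc k h g, hconj k e, hconj (k * h) e, h2, zero_add, h2]
    · have e : h * σ = σ * h := hcomm h1 h3 h4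
      rw [hconj k e, hconj (k * g) e, add_assoc, h2]
  refine tripleSum_eq_zero_of_relation ρ hirr hV hcard ?_ habc
  intro u u' v v' w hn
  obtain ⟨u'', hu⟩ := exists_notMem_of_length_lt_card [u, u', v, v', w] (by simp; omega)
  obtain ⟨v'', hv⟩ := exists_notMem_of_length_lt_card [u, u', v, v', w, u''] (by simp; omega)
  obtain ⟨k, hk, hkl⟩ := exists_even_map_eq (l := [x, x', x'', y, y', y'', z])
    (l' := [u, u', u'', v, v', v'', w]) hnd (by
      clear * - hn hu hv
      simp only [List.nodup_cons, List.mem_cons, List.not_mem_nil, or_false, not_or] at *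
      grind) rfl (by simpa using hcard)
  simp only [List.map_cons, List.map_nil, List.cons.injEq, and_true] at hkl
  obtain ⟨rfl, rfl, rfl, rfl, rfl, rfl, rfl⟩ := hkl
  have e1 := hD k hk
  have e2 := hD (k * g) (mul_mem hk hgA)
  have e3 := hD (k * h) (mul_mem hk hhA)
  have e4 := hD (k * g * h) (mul_mem (mul_mem hk hgA) hhA)
  have hy : g y = y := hgf y (by clear * - hd; grind)
  have hy' : g y' = y' := hgf y' (by clear * - hd; grind)
  have hz : g z = z := hgf z (by clear * - hd; grind)
  have hx : h x = x := hhf x (by clear * - hd; grind)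
  have hz' : h z = z := hhf z (by clear * - hd; grind)
  simp only [Perm.mul_apply, hy, hy', hz, hx, hz', hgx, hhy] at e2 e3 e4
  rw [e1, e2, e3, e4]
  calc _ = ((1 + C) + (1 + C)) + ((1 + C) + (1 + C)) +
        (D k + D (k * g) + D (k * h) + D (k * g * h)) := by abel
    _ = 0 := by rw [h2, hDk, add_zero]

end TransportOfClassSums

section DimensionOfAlternatingModule

open Equiv Equiv.Perm

variable {Ω : Type*} [Fintype Ω] [DecidableEq Ω]
variable {F V : Type*} [Field F] [CharP F 2] [AddCommGroup V] [Module F V]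

omit [Fintype Ω] in
lemma mul_swap_comm {σ : Perm Ω} {x y : Ω} (hx : σ x = x) (hy : σ y = y) :
    σ * swap x y = swap x y * σ := by
  rw [mul_swap_eq_swap_mul, hx, hy]

theorem two_pow_le_finrank_of_three_cycle_sum [IsAlgClosed F] [FiniteDimensional F V]
    [Nontrivial V] (ρ : Representation F (alternatingGroup Ω) V)
    (hE : ∀ a b c, [a, b, c].Nodup → 1 + altOp ρ (swap a b * swap b c) +
      altOp ρ (swap a b * swap b c) * altOp ρ (swap a b * swap b c) = 0)
    (r : ℕ) (hr : 3 * r + 2 ≤ Fintype.card Ω) : 2 ^ r ≤ Module.finrank F V := by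
  obtain ⟨ω, hω⟩ : ∃ ω : F, ω ^ 2 = ω + 1 := by
    have hdeg : (Polynomial.X ^ 2 + Polynomial.X + 1 : Polynomial F).natDegree = 2 := by
      compute_degree!
    obtain ⟨ω, hω⟩ := IsAlgClosed.exists_root (Polynomial.X ^ 2 + Polynomial.X + 1 : Polynomial F)
      (fun h => by
        rw [Polynomial.natDegree_eq_of_degree_eq_some h] at hdeg
        exact absurd hdeg (by norm_num))
    refine ⟨ω, ?_⟩
    simp only [Polynomial.IsRoot.def, Polynomial.eval_add, Polynomial.eval_pow,
      Polynomial.eval_X, Polynomial.eval_one] at hω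
    have h2 : (2 : F) = 0 := CharTwo.two_eq_zero
    linear_combination hω - (ω + 1) * h2
  obtain ⟨e⟩ : Nonempty ((Fin r × Fin 3) ⊕ Fin 2 ↪ Ω) :=
    Function.Embedding.nonempty_of_card_le (by simp; omega)
  let t : Fin r → Fin 3 → Ω := fun i j => e (Sum.inl (i, j))
  let p : Fin 2 → Ω := fun j => e (Sum.inr j)
  have ht : ∀ {i j i' j'}, t i j = t i' j' ↔ i = i' ∧ j = j' := by simp [t]
  have hp : p 0 ≠ p 1 := by simp [p]
  have htp : ∀ {i j k}, t i j ≠ p k := by simp [t, p]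
  have h01 : ∀ i, t i 0 ≠ t i 1 := by simp [ht]
  have h02 : ∀ i, t i 0 ≠ t i 2 := by simp [ht]
  have h12 : ∀ i, t i 1 ≠ t i 2 := by simp [ht]
  let c : Fin r → Perm Ω := fun i => swap (t i 0) (t i 1) * swap (t i 1) (t i 2)
  let g : Fin r → Perm Ω := fun i => swap (t i 0) (t i 1) * swap (p 0) (p 1)
  have hcm : ∀ i, c i ∈ alternatingGroup Ω := fun i =>
    swap_mul_swap_mem_alternatingGroup (h01 i) (h12 i)
  have hgm : ∀ i, g i ∈ alternatingGroup Ω := fun i =>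
    swap_mul_swap_mem_alternatingGroup (h01 i) hp
  have hcp : ∀ i k, c i (p k) = p k := fun i k => by
    simp only [c, Perm.mul_apply]
    rw [swap_apply_of_ne_of_ne htp.symm htp.symm, swap_apply_of_ne_of_ne htp.symm htp.symm]
  have hct : ∀ {i i'} k, i ≠ i' → c i (t i' k) = t i' k := fun {i i'} k h => by
    have h' : ∀ l, t i' k ≠ t i l := fun l h1 => h (ht.mp h1).1.symm
    simp only [c, Perm.mul_apply]
    rw [swap_apply_of_ne_of_ne (h' _) (h' _), swap_apply_of_ne_of_ne (h' _) (h' _)]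
  have hpt : ∀ i k, swap (p 0) (p 1) (t i k) = t i k := fun i k =>
    swap_apply_of_ne_of_ne htp htp
  have hW : (⊤ : Submodule F V) ≠ ⊥ := top_ne_bot
  have := two_pow_card_le_finrank_of_inverted hω (fun i => altOp ρ (c i)) (fun i => altOp ρ (g i))
    (fun i => hE _ _ _ (by simp [h01 i, h02 i, h12 i])) ?_ ?_ ?_ ?_ Finset.univ ⊤ hW
    (fun _ _ _ _ => Submodule.mem_top) (fun _ _ _ _ => Submodule.mem_top)
  · simpa using this
  · intro i j hij
    rw [← altOp_mul ρ (hcm i), ← altOp_mul ρ (hcm j)]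
    congr 1
    rw [show c j = swap (t j 0) (t j 1) * swap (t j 1) (t j 2) from rfl, ← mul_assoc,
      mul_swap_comm (hct 0 hij) (hct 1 hij), mul_assoc, mul_swap_comm (hct 1 hij) (hct 2 hij),
      mul_assoc]
  · intro i
    rw [← altOp_mul ρ (hgm i), show g i * g i = 1 from ?_, altOp_one]
    simp only [g]
    rw [mul_assoc, ← mul_assoc (swap (p 0) (p 1)), mul_swap_comm (hpt i 0) (hpt i 1), mul_assoc,
      swap_mul_self, mul_one, swap_mul_self]
  · intro i
    rw [← altOp_mul ρ (hcm i), ← altOp_mul ρ (hcm i), ← altOp_mul ρ (hgm i)]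
    congr 1
    simp only [c, g]
    rw [swap_mul_swap_mul_self (h01 i) (h02 i) (h12 i), mul_assoc (swap (t i 0) (t i 1)),
      mul_assoc (swap (t i 0) (t i 1)), ← mul_assoc (swap (p 0) (p 1)),
      mul_swap_comm (hpt i 1) (hpt i 2), mul_assoc (swap (t i 1) (t i 2)),
      mul_swap_comm (hpt i 0) (hpt i 1)]
  · intro i j hij
    rw [← altOp_mul ρ (hcm i), ← altOp_mul ρ (hgm j)]
    congr 1
    simp only [g]
    rw [← mul_assoc, mul_swap_comm (hct 0 hij) (hct 1 hij), mul_assoc,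
      mul_swap_comm (hcp i 0) (hcp i 1), mul_assoc]

end DimensionOfAlternatingModule

section DimensionContradiction

open Equiv Equiv.Perm

lemma factorial_pow_three_lt {m : ℕ} (hm : 11 ≤ m) :
    m.factorial ^ 3 < 2 ^ ((m - 1) * (m - 2) - 5) := by
  obtain ⟨k, rfl⟩ := Nat.exists_eq_add_of_le' hm
  induction k with
  | zero => decide +kernel
  | succ k ih =>
    have h1 : ∀ j : ℕ, (j + 12) ^ 3 ≤ 2 ^ (2 * (j + 10)) := by
      intro j
      induction j with
      | zero => norm_num
      | succ j ihj =>
        calc (j + 1 + 12) ^ 3 ≤ 4 * (j + 12) ^ 3 := by ring_nf; nlinarith [Nat.zero_le (j ^ 3)]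
          _ ≤ 4 * 2 ^ (2 * (j + 10)) := by omega
          _ = 2 ^ (2 * (j + 1 + 10)) := by ring
    have h2 : (k + 1 + 11 - 1) * (k + 1 + 11 - 2) - 5 =
        2 * (k + 10) + ((k + 11 - 1) * (k + 11 - 2) - 5) := by
      have e1 : k + 1 + 11 - 1 = k + 11 := by omega
      have e2 : k + 1 + 11 - 2 = k + 10 := by omega
      have e3 : k + 11 - 1 = k + 10 := by omega
      have e4 : k + 11 - 2 = k + 9 := by omega
      rw [e1, e2, e3, e4, ← Nat.add_sub_assoc (by nlinarith)]
      congr 1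
      ring
    rw [h2, pow_add, show k + 1 + 11 = k + 11 + 1 by omega, Nat.factorial_succ, mul_pow]
    exact Nat.mul_lt_mul_of_le_of_lt (h1 k) (ih (by omega)) (by positivity)

variable {Ω : Type*} [Fintype Ω] [DecidableEq Ω]
variable {F V : Type*} [Field F] [CharP F 2] [AddCommGroup V] [Module F V]

theorem not_repIrreducible_of_three_cycle_sum [IsAlgClosed F] {m : ℕ} (hm : 11 ≤ m)
    (f : alternatingGroup (Fin m) →* Perm Ω) (hX : f.range ≤ alternatingGroup Ω)
    (ρ : Representation F (alternatingGroup Ω) V) (hV : 1 < Module.rank F V)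
    (hcard : (m - 1) * (m - 2) ≤ 2 * Fintype.card Ω)
    (hE : RepIrreducible (ρ.comp (Subgroup.inclusion hX)) → ∀ a b c, [a, b, c].Nodup →
      1 + altOp ρ (swap a b * swap b c) +
        altOp ρ (swap a b * swap b c) * altOp ρ (swap a b * swap b c) = 0) :
    ¬ RepIrreducible (ρ.comp (Subgroup.inclusion hX)) := by
  intro hirr
  have hfin : FiniteDimensional F V := hirr.finiteDimensional
  have hnon : Nontrivial V := by
    by_contra h
    rw [not_nontrivial_iff_subsingleton] at h
    rw [rank_subsingleton'] at hV
    exact absurd hV (by simp)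
  have hsize : 90 ≤ 2 * Fintype.card Ω :=
    le_trans (Nat.mul_le_mul (by omega : 10 ≤ m - 1) (by omega : 9 ≤ m - 2)) hcard
  set r := (Fintype.card Ω - 2) / 3 with hr
  have h1 := two_pow_le_finrank_of_three_cycle_sum ρ (hE hirr) r (by omega)
  have h2 := hirr.finrank_sq_le_card
  have h3 : 2 * Nat.card f.range ≤ m.factorial := by
    have : Nontrivial (Fin m) := Fin.nontrivial_iff_two_le.mpr (by omega)
    have e := two_mul_nat_card_alternatingGroup (α := Fin m)
    have e2 : Nat.card f.range ≤ Nat.card (alternatingGroup (Fin m)) :=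
      Nat.card_le_card_of_surjective f.rangeRestrict f.rangeRestrict_surjective
    rw [Nat.card_perm, Nat.card_eq_fintype_card (α := Fin m), Fintype.card_fin] at e
    omega
  have h4 : 2 ^ (2 * r + 1) ≤ m.factorial := by
    calc 2 ^ (2 * r + 1) = 2 * (2 ^ r) ^ 2 := by ring
      _ ≤ 2 * Module.finrank F V ^ 2 := by gcongr
      _ ≤ m.factorial := by omega
  have h5 := (Nat.pow_le_pow_left h4 3).trans_lt (factorial_pow_three_lt hm)
  rw [← pow_mul, Nat.pow_lt_pow_iff_right (by norm_num)] at h5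
  omega

end DimensionContradiction

section ActionOfAlternatingGroup

open Equiv Equiv.Perm

variable {m : ℕ} {Ω : Type*} [Fintype Ω] [DecidableEq Ω] [MulAction (Perm (Fin m)) Ω]

lemma range_toPermHom_le_alternatingGroup :
    (MulAction.toPermHom (alternatingGroup (Fin m)) Ω).range ≤ alternatingGroup Ω := by
  let χ : Perm (Fin m) →* ℤˣ := sign.comp (MulAction.toPermHom (Perm (Fin m)) Ω)
  have hle : alternatingGroup (Fin m) ≤ χ.ker := by
    rw [← closure_three_cycles_eq_alternating, Subgroup.closure_le]
    intro c hc
    have h3 : c ^ 3 = 1 := by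
      rw [← hc.orderOf]; exact pow_orderOf_eq_one c
    have h4 : c = c ^ 2 * c ^ 2 := by
      rw [← pow_add, show 2 + 2 = 3 + 1 from rfl, pow_succ, h3, one_mul]
    rw [SetLike.mem_coe, MonoidHom.mem_ker, h4, map_mul]
    exact Int.units_mul_self _
  rintro _ ⟨g, rfl⟩
  exact hle g.2

omit [Fintype Ω] [DecidableEq Ω] in
lemma exists_perm_of_mem_range {g : Perm Ω}
    (hg : g ∈ (MulAction.toPermHom (alternatingGroup (Fin m)) Ω).range) :
    ∃ σ : Perm (Fin m), ∀ x, g x = σ • x := by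
  obtain ⟨σ, rfl⟩ := hg
  exact ⟨σ, fun x => rfl⟩

end ActionOfAlternatingGroup

section Subsets

open Equiv Equiv.Perm

lemma choose_two_le_choose {n k : ℕ} (hk : 2 ≤ k) (hkn : 2 * k ≤ n) :
    n.choose 2 ≤ n.choose k := by
  induction k, hk using Nat.le_induction with
  | base => exact le_rfl
  | succ k hk ih =>
    exact (ih (by omega)).trans (Nat.choose_le_succ_of_lt_half_left (by omega))

lemma card_KSub_ge {m k : ℕ} (hk : 2 ≤ k) (hkm : 2 * k < m) :
    (m - 1) * (m - 2) ≤ 2 * Fintype.card (KSub m k) := by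
  rw [Fintype.card_finset_len, Fintype.card_fin]
  have h := choose_two_le_choose hk (n := m) (by omega)
  have h3 := Nat.choose_two_right m
  have h4 : m * (m - 1) / 2 * 2 = m * (m - 1) :=
    Nat.div_mul_cancel (Nat.even_mul_pred_self m).two_dvd
  have h5 : (m - 1) * (m - 2) ≤ m * (m - 1) := by
    rw [mul_comm m]; exact Nat.mul_le_mul_left _ (by omega)
  omega

lemma exists_isosceles_KSub {m k j : ℕ} (hm : 11 ≤ m) (hkm : 2 * k < m) (hj : 1 ≤ j)
    (hj3 : j ≤ 3) (hjk : j ≤ k) :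
    ∃ x y z : KSub m k, [x, y, z].Nodup ∧ (x.1 ∩ y.1).card = k - j ∧
      (x.1 ∩ z.1).card = (y.1 ∩ z.1).card := by
  obtain ⟨S, -, hS⟩ := Finset.exists_subset_card_eq (s := (Finset.univ : Finset (Fin m))) (n := j)
    (by simp; omega)
  obtain ⟨T, hTS, hT⟩ := Finset.exists_subset_card_eq (s := Sᶜ) (n := j)
    (by rw [Finset.card_compl, Fintype.card_fin, hS]; omega)
  have hST : Disjoint S T := by
    rw [Finset.disjoint_left]; intro i hi hi'; exact Finset.mem_compl.mp (hTS hi') hi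
  have hcard : (S ∪ T)ᶜ.card = m - 2 * j := by
    rw [Finset.card_compl, Fintype.card_fin, Finset.card_union_of_disjoint hST]; omega
  obtain ⟨R, hRS, hR⟩ := Finset.exists_subset_card_eq (s := (S ∪ T)ᶜ) (n := k - j) (by omega)
  obtain ⟨z, hzS, hz⟩ := Finset.exists_subset_card_eq (s := (S ∪ T)ᶜ) (n := k) (by omega)
  have hSR : Disjoint S R := by
    rw [Finset.disjoint_left]; intro i hi hi'; have := hRS hi'; simp at this; exact this.1 hi
  have hTR : Disjoint T R := by
    rw [Finset.disjoint_left]; intro i hi hi'; have := hRS hi'; simp at this; exact this.2 hi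
  have hSz : Disjoint S z := by
    rw [Finset.disjoint_left]; intro i hi hi'; have := hzS hi'; simp at this; exact this.1 hi
  have hTz : Disjoint T z := by
    rw [Finset.disjoint_left]; intro i hi hi'; have := hzS hi'; simp at this; exact this.2 hi
  obtain ⟨s, hs⟩ : S.Nonempty := by rw [← Finset.card_pos]; omega
  obtain ⟨t, ht⟩ : T.Nonempty := by rw [← Finset.card_pos]; omega
  have hsz := Finset.disjoint_left.mp hSz hs
  have htz := Finset.disjoint_left.mp hTz ht
  have hsT := Finset.disjoint_left.mp hST hs
  have hsR := Finset.disjoint_left.mp hSR hs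
  refine ⟨⟨S ∪ R, by rw [Finset.card_union_of_disjoint hSR]; omega⟩,
    ⟨T ∪ R, by rw [Finset.card_union_of_disjoint hTR]; omega⟩, ⟨z, hz⟩, ?_, ?_, ?_⟩
  · have h1 : S ∪ R ≠ T ∪ R := fun h => by
      have : s ∈ T ∪ R := h ▸ Finset.mem_union_left R hs
      simp [hsT, hsR] at this
    have h2 : S ∪ R ≠ z := fun h => hsz (h ▸ Finset.mem_union_left R hs)
    have h3 : T ∪ R ≠ z := fun h => htz (h ▸ Finset.mem_union_left R ht)
    simp [h1, h2, h3]
  · rw [← Finset.inter_union_distrib_right, Finset.disjoint_iff_inter_eq_empty.mp hST,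
      Finset.empty_union, hR]
  · rw [Finset.union_inter_distrib_right, Finset.union_inter_distrib_right,
      Finset.disjoint_iff_inter_eq_empty.mp hSz, Finset.disjoint_iff_inter_eq_empty.mp hTz]

variable {F V : Type*} [Field F] [IsAlgClosed F] [CharP F 2] [AddCommGroup V] [Module F V]

theorem three_cycle_sum_eq_zero_of_subsets {m k : ℕ} (hm : 11 ≤ m) (hk : 3 ≤ k) (hkm : 2 * k < m)
    {hX : (MulAction.toPermHom (alternatingGroup (Fin m)) (KSub m k)).range ≤
      alternatingGroup (KSub m k)}
    (ρ : Representation F (alternatingGroup (KSub m k)) V)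
    (hirr : RepIrreducible (ρ.comp (Subgroup.inclusion hX))) (hV : 1 < Module.rank F V)
    {a b c : KSub m k} (habc : [a, b, c].Nodup) :
    1 + altOp ρ (swap a b * swap b c) +
      altOp ρ (swap a b * swap b c) * altOp ρ (swap a b * swap b c) = 0 := by
  have hcard := card_KSub_ge (by omega : 2 ≤ k) hkm
  have hsize : 10 * 9 ≤ (m - 1) * (m - 2) := Nat.mul_le_mul (by omega) (by omega)
  refine three_cycle_sum_eq_zero_of_invariant ρ hirr hV (by omega)
    (fun x y => (x.1 ∩ y.1).card) (fun x y => by rw [Finset.inter_comm]) ?_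
    (fun i : Fin 3 => k - (i.1 + 1)) ?_ ?_ habc
  · intro g hg x y
    obtain ⟨σ, hσ⟩ := exists_perm_of_mem_range hg
    rw [hσ, hσ]
    change (σ • x.1 ∩ σ • y.1).card = _
    rw [← Finset.smul_finset_inter, Finset.card_smul_finset]
  · intro i j hij
    apply Fin.ext
    simp only at hij
    omega
  · intro i
    exact exists_isosceles_KSub hm hkm (by omega) (by omega) (by omega)

end Subsets

section Pairs

open Equiv Equiv.Perm

lemma swap_mul_swap_rotate {α : Type*} [DecidableEq α] {x y z : α} (h : [x, y, z].Nodup) :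
    swap y z * swap z x = swap x y * swap y z := by
  simp only [List.nodup_cons, List.mem_cons, List.not_mem_nil, or_false, not_or] at h
  ext t
  simp only [Perm.mul_apply, swap_apply_def]
  grind

lemma swap_mul_swap_eq_or {α : Type*} [DecidableEq α] {x y z A B C : α} (h : [x, y, z].Nodup)
    (hx : x ∈ [A, B, C]) (hy : y ∈ [A, B, C]) (hz : z ∈ [A, B, C]) :
    swap A B * swap B C = swap x y * swap y z ∨ swap A B * swap B C = swap y z * swap x y := by
  have h1 := swap_mul_swap_rotate h
  have h2 := swap_mul_swap_rotate (x := y) (y := z) (z := x) (by clear * - h; grind)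
  have h3 := swap_mul_swap_rotate (x := z) (y := y) (z := x) (by clear * - h; grind)
  have h4 := swap_mul_swap_rotate (x := y) (y := x) (z := z) (by clear * - h; grind)
  have h5 : swap y x = swap x y := swap_comm y x
  have h6 : swap z y = swap y z := swap_comm z y
  have h7 : swap z x = swap x z := swap_comm z x
  simp only [List.nodup_cons, List.mem_cons, List.not_mem_nil, or_false, not_or] at h hx hy hz
  rcases hx with rfl | rfl | rfl <;> rcases hy with rfl | rfl | rfl <;>
    rcases hz with rfl | rfl | rfl <;> first | (exfalso; tauto) | skip
  all_goals
    simp only [h5, h6, h7] at h1 h2 h3 h4 ⊢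
    grind

lemma eq_pair_of_subset_triple {α : Type*} [DecidableEq α] {p q r : α} {R : Finset α}
    (hR : R.card = 2) (hs : R ⊆ {p, q, r}) (h1 : R ≠ {p, q}) (h2 : R ≠ {p, r}) :
    R = {q, r} := by
  obtain ⟨u, v, huv, rfl⟩ := Finset.card_eq_two.mp hR
  have hu := hs (Finset.mem_insert_self u {v})
  have hv := hs (Finset.mem_insert_of_mem (Finset.mem_singleton_self v))
  simp only [Finset.mem_insert, Finset.mem_singleton] at hu hv
  rcases hu with rfl | rfl | rfl <;> rcases hv with rfl | rfl | rfl <;>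
    first
    | exact absurd rfl huv
    | exact absurd rfl h1
    | exact absurd rfl h2
    | exact absurd (Finset.pair_comm _ _) h1
    | exact absurd (Finset.pair_comm _ _) h2
    | rfl
    | exact Finset.pair_comm _ _

/-- The `3`-cycles on the edges of the triangles of the complete graph on `Fin m`. -/
noncomputable def triangleCycles (m : ℕ) : Finset (Perm (KSub m 2)) :=
  open Classical in
  Finset.univ.filter fun σ => ∃ A B C : KSub m 2, [A, B, C].Nodup ∧
    (A.1 ∪ B.1 ∪ C.1).card = 3 ∧ σ = swap A B * swap B C

lemma mem_triangleCycles {m : ℕ} {σ : Perm (KSub m 2)} :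
    σ ∈ triangleCycles m ↔ ∃ A B C : KSub m 2, [A, B, C].Nodup ∧
      (A.1 ∪ B.1 ∪ C.1).card = 3 ∧ σ = swap A B * swap B C := by
  simp [triangleCycles]

lemma conj_mem_triangleCycles {m : ℕ} {g σ : Perm (KSub m 2)}
    (hg : g ∈ (MulAction.toPermHom (alternatingGroup (Fin m)) (KSub m 2)).range)
    (hσ : σ ∈ triangleCycles m) : g * σ * g⁻¹ ∈ triangleCycles m := by
  obtain ⟨A, B, C, hnd, hcard, rfl⟩ := mem_triangleCycles.mp hσ
  obtain ⟨τ, hτ⟩ := exists_perm_of_mem_range hg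
  refine mem_triangleCycles.mpr ⟨g A, g B, g C, hnd.map g.injective, ?_, ?_⟩
  · rw [hτ, hτ, hτ]
    change (τ • A.1 ∪ τ • B.1 ∪ τ • C.1).card = 3
    rw [← Finset.smul_finset_union, ← Finset.smul_finset_union, Finset.card_smul_finset, hcard]
  · rw [swap_apply_apply, swap_apply_apply]
    group

/-- A member of `triangleCycles m` that moves edges of both lists is one of the two `3`-cycles on
`x`, `y`, `z`. -/
lemma triangleCycles_fixed {m : ℕ} {x y z : KSub m 2} {L M : List (KSub m 2)}
    {p q r : Fin m} (hx : x.1 = {p, q}) (hy : y.1 = {p, r}) (hz : z.1 = {q, r})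
    (hnd : [x, y, z].Nodup)
    (hLM : ∀ P ∈ L, ∀ Q ∈ M, (P = x ∧ Q = y) ∨ Disjoint P.1 Q.1)
    {σ : Perm (KSub m 2)} (hσ : σ ∈ triangleCycles m) :
    σ = swap x y * swap y z ∨ σ = swap y z * swap x y ∨ (∀ P ∈ L, σ P = P) ∨
      ∀ Q ∈ M, σ Q = Q := by
  obtain ⟨A, B, C, hABC, hcard, rfl⟩ := mem_triangleCycles.mp hσ
  by_cases hL : ∃ P ∈ L, P ∈ [A, B, C]
  swap
  · push Not at hL
    refine Or.inr (Or.inr (Or.inl fun P hP => ?_))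
    have := hL P hP
    simp only [List.mem_cons, List.not_mem_nil, or_false, not_or] at this
    rw [Perm.mul_apply, swap_apply_of_ne_of_ne this.2.1 this.2.2,
      swap_apply_of_ne_of_ne this.1 this.2.1]
  by_cases hM : ∃ Q ∈ M, Q ∈ [A, B, C]
  swap
  · push Not at hM
    refine Or.inr (Or.inr (Or.inr fun P hP => ?_))
    have := hM P hP
    simp only [List.mem_cons, List.not_mem_nil, or_false, not_or] at this
    rw [Perm.mul_apply, swap_apply_of_ne_of_ne this.2.1 this.2.2,
      swap_apply_of_ne_of_ne this.1 this.2.1]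
  obtain ⟨P, hPL, hP⟩ := hL
  obtain ⟨Q, hQM, hQ⟩ := hM
  have hsub : ∀ R ∈ [A, B, C], R.1 ⊆ A.1 ∪ B.1 ∪ C.1 := by
    intro R hR
    simp only [List.mem_cons, List.not_mem_nil, or_false] at hR
    rcases hR with rfl | rfl | rfl
    · exact Finset.subset_union_left.trans Finset.subset_union_left
    · exact Finset.subset_union_right.trans Finset.subset_union_left
    · exact Finset.subset_union_right
  rcases hLM P hPL Q hQM with ⟨rfl, rfl⟩ | hdis
  swap
  · have h := Finset.card_le_card (Finset.union_subset (hsub P hP) (hsub Q hQ))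
    rw [Finset.card_union_of_disjoint hdis, P.2, Q.2, hcard] at h
    omega
  have hU : ({p, q, r} : Finset (Fin m)) = A.1 ∪ B.1 ∪ C.1 := by
    refine Finset.eq_of_subset_of_card_le ?_ ?_
    · have h := Finset.union_subset (hsub P hP) (hsub Q hQ)
      rw [hx, hy] at h
      intro i hi
      apply h
      simp only [Finset.mem_insert, Finset.mem_singleton, Finset.mem_union] at hi ⊢
      tauto
    · rw [hcard]
      by_contra! hlt
      have hPsub : P.1 ⊆ ({p, q, r} : Finset (Fin m)) := by
        rw [hx]; intro i hi
        simp only [Finset.mem_insert, Finset.mem_singleton] at hi ⊢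
        tauto
      have hQsub : Q.1 ⊆ ({p, q, r} : Finset (Fin m)) := by
        rw [hy]; intro i hi
        simp only [Finset.mem_insert, Finset.mem_singleton] at hi ⊢
        tauto
      have e1 := Finset.eq_of_subset_of_card_le hPsub (by rw [P.2]; omega)
      have e2 := Finset.eq_of_subset_of_card_le hQsub (by rw [Q.2]; omega)
      simp only [List.nodup_cons, List.mem_cons, not_or] at hnd
      exact hnd.1.1 (Subtype.ext (e1.trans e2.symm))
  have hthird : ∀ R ∈ [A, B, C], R ≠ P → R ≠ Q → R = z := by
    intro R hR h1 h2
    apply Subtype.ext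
    rw [hz]
    refine eq_pair_of_subset_triple R.2 (hU ▸ hsub R hR) ?_ ?_
    · rw [← hx]; exact fun h => h1 (Subtype.ext h)
    · rw [← hy]; exact fun h => h2 (Subtype.ext h)
  have hzm : z ∈ [A, B, C] := by
    have hA := hthird A (by simp)
    have hB := hthird B (by simp)
    have hC := hthird C (by simp)
    clear * - hnd hABC hA hB hC hP hQ
    simp only [List.nodup_cons, List.mem_cons, List.not_mem_nil, or_false, not_or] at *
    grind
  rcases swap_mul_swap_eq_or hnd hP hQ hzm with h | h
  · exact Or.inl h
  · exact Or.inr (Or.inl h)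

variable {F V : Type*} [Field F] [IsAlgClosed F] [CharP F 2] [AddCommGroup V] [Module F V]

theorem three_cycle_sum_eq_zero_of_pairs {m : ℕ} (hm : 11 ≤ m)
    {hX : (MulAction.toPermHom (alternatingGroup (Fin m)) (KSub m 2)).range ≤
      alternatingGroup (KSub m 2)}
    (ρ : Representation F (alternatingGroup (KSub m 2)) V)
    (hirr : RepIrreducible (ρ.comp (Subgroup.inclusion hX))) (hV : 1 < Module.rank F V)
    {a b c : KSub m 2} (habc : [a, b, c].Nodup) :
    1 + altOp ρ (swap a b * swap b c) +
      altOp ρ (swap a b * swap b c) * altOp ρ (swap a b * swap b c) = 0 := by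
  have hcard := card_KSub_ge le_rfl (by omega : 2 * 2 < m)
  have hsize : 10 * 9 ≤ (m - 1) * (m - 2) := Nat.mul_le_mul (by omega) (by omega)
  let e : Fin 11 → Fin m := Fin.castLE hm
  have he : Function.Injective e := Fin.castLE_injective hm
  let E : (i j : Fin 11) → i ≠ j → KSub m 2 := fun i j h =>
    ⟨{e i, e j}, Finset.card_pair (he.ne h)⟩
  have hval : ∀ i j h, (E i j h).1 = ({i, j} : Finset (Fin 11)).image e := by
    intro i j h
    rw [Finset.image_insert, Finset.image_singleton]
  have hE : ∀ i j h i' j' h', ({i, j} : Finset (Fin 11)) ≠ {i', j'} → E i j h ≠ E i' j' h' := by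
    intro i j h i' j' h' hne heq
    have h2 := congrArg Subtype.val heq
    rw [hval _ _ h, hval _ _ h'] at h2
    exact hne (Finset.image_injective he h2)
  have hEd : ∀ i j h i' j' h', Disjoint ({i, j} : Finset (Fin 11)) {i', j'} →
      Disjoint (E i j h).1 (E i' j' h').1 := by
    intro i j h i' j' h' hd
    rw [hval _ _ h, hval _ _ h']
    exact (Finset.disjoint_image he).mpr hd
  let x := E 0 1 (by decide)
  let y := E 0 2 (by decide)
  let z := E 1 2 (by decide)
  have hnd : [x, y, z].Nodup := by
    simp only [List.nodup_cons, List.mem_cons, List.not_mem_nil, or_false, not_or,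
      List.nodup_nil, not_false_eq_true, and_true]
    refine ⟨⟨?_, ?_⟩, ?_⟩ <;> exact hE _ _ (by decide) _ _ (by decide) (by decide)
  have hcard3 : (x.1 ∪ y.1 ∪ z.1).card = 3 := by
    rw [hval 0 1 (by decide), hval 0 2 (by decide), hval 1 2 (by decide),
      ← Finset.image_union, ← Finset.image_union, Finset.card_image_of_injective _ he]
    decide
  rw [← tripleSum_eq ρ habc]
  refine tripleSum_eq_zero_of_invariant_set ρ hirr hV (by omega) (triangleCycles m)
    (fun g hg σ hσ => conj_mem_triangleCycles hg hσ) (x := x) (y := y) (z := z)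
    (x' := E 3 4 (by decide)) (x'' := E 5 6 (by decide))
    (y' := E 7 8 (by decide)) (y'' := E 9 10 (by decide)) ?_ ?_ ?_ ?_ habc
  · simp only [List.nodup_cons, List.mem_cons, List.not_mem_nil, or_false, not_or,
      List.nodup_nil, not_false_eq_true, and_true]
    refine ⟨⟨?_, ?_, ?_, ?_, ?_, ?_⟩, ⟨?_, ?_, ?_, ?_, ?_⟩, ⟨?_, ?_, ?_, ?_⟩, ⟨?_, ?_, ?_⟩,
      ⟨?_, ?_⟩, ?_⟩ <;> exact hE _ _ (by decide) _ _ (by decide) (by decide)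
  · exact mem_triangleCycles.mpr ⟨x, y, z, hnd, hcard3, rfl⟩
  · refine mem_triangleCycles.mpr ⟨z, y, x, List.nodup_reverse.mpr hnd, ?_, ?_⟩
    · rw [Finset.union_comm, Finset.union_comm z.1, ← Finset.union_assoc]
      exact hcard3
    · rw [swap_comm z, swap_comm y x]
  · intro σ hσ
    have h := triangleCycles_fixed (L := [x, E 3 4 (by decide), E 5 6 (by decide)])
      (M := [y, E 7 8 (by decide), E 9 10 (by decide)])
      (rfl : x.1 = _) (rfl : y.1 = _) (rfl : z.1 = _) hnd ?_ hσ
    · simpa only [List.forall_mem_cons, List.not_mem_nil, false_imp_iff, implies_true,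
        and_true] using h
    · simp only [List.forall_mem_cons, List.not_mem_nil, false_imp_iff, implies_true, and_true]
      refine ⟨⟨?_, ?_, ?_⟩, ⟨?_, ?_, ?_⟩, ⟨?_, ?_, ?_⟩⟩
      · exact Or.inl trivial
      all_goals exact Or.inr (hEd _ _ (by decide) _ _ (by decide) (by decide))

end Pairs

section Partitions

open Equiv Equiv.Perm

variable {m a b : ℕ}

/-- `i` and `j` lie in the same block of `P`. -/
def SameBlock (P : Partn m a b) (i j : Fin m) : Prop := ∃ A ∈ P.1, i ∈ A ∧ j ∈ A

lemma sameBlock_smul (g : Perm (Fin m)) (P : Partn m a b) (i j : Fin m) :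
    SameBlock (g • P) (g i) (g j) ↔ SameBlock P i j := by
  constructor
  · rintro ⟨A, hA, hi, hj⟩
    obtain ⟨B, hB, rfl⟩ := Finset.mem_smul_finset.mp (show A ∈ g • P.1 from hA)
    exact ⟨B, hB, (Finset.smul_mem_smul_finset_iff g).mp hi,
      (Finset.smul_mem_smul_finset_iff g).mp hj⟩
  · rintro ⟨A, hA, hi, hj⟩
    exact ⟨g • A, Finset.smul_mem_smul_finset (s := P.1) hA, Finset.smul_mem_smul_finset hi,
      Finset.smul_mem_smul_finset hj⟩

open Classical in
/-- The size of the intersection of the blocks of `P` and `Q` that contain `i`. -/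
noncomputable def cellSize (P Q : Partn m a b) (i : Fin m) : ℕ :=
  (Finset.univ.filter fun j => SameBlock P i j ∧ SameBlock Q i j).card

/-- The number of points at which `cellSize P Q` takes a given value. -/
noncomputable def cellDistribution (P Q : Partn m a b) (n : ℕ) : ℕ :=
  (Finset.univ.filter fun i => cellSize P Q i = n).card

lemma cellDistribution_comm (P Q : Partn m a b) :
    cellDistribution P Q = cellDistribution Q P := by
  have h : ∀ i, cellSize P Q i = cellSize Q P i := fun i => by
    unfold cellSize
    congr 1
    ext j
    simp [and_comm]
  funext n
  simp only [cellDistribution, h]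

lemma cellSize_smul (g : Perm (Fin m)) (P Q : Partn m a b) (i : Fin m) :
    cellSize (g • P) (g • Q) (g i) = cellSize P Q i := by
  refine (Finset.card_equiv g fun j => ?_).symm
  simp [sameBlock_smul]

lemma cellDistribution_smul (g : Perm (Fin m)) (P Q : Partn m a b) :
    cellDistribution (g • P) (g • Q) = cellDistribution P Q := by
  funext n
  refine (Finset.card_equiv g fun j => ?_).symm
  simp [cellSize_smul]

/-- The partition whose blocks are the fibres of `i ↦ (e i).2`. -/
def Partn.ofEquiv (ha : 0 < a) (e : Fin m ≃ Fin a × Fin b) : Partn m a b :=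
  ⟨Finset.univ.image fun c => Finset.univ.image fun k => e.symm (k, c), by
    have hmem : ∀ i c, i ∈ Finset.univ.image (fun k => e.symm (k, c)) ↔ (e i).2 = c := by
      intro i c
      simp only [Finset.mem_image, Finset.mem_univ, true_and]
      constructor
      · rintro ⟨k, rfl⟩; simp
      · rintro rfl; exact ⟨(e i).1, by simp⟩
    refine ⟨?_, ?_, fun i => ⟨_, ⟨Finset.mem_image_of_mem _ (Finset.mem_univ (e i).2),
      (hmem _ _).mpr rfl⟩, ?_⟩⟩
    · rw [Finset.card_image_of_injective, Finset.card_univ, Fintype.card_fin]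
      intro c d hcd
      have h := (hmem (e.symm (⟨0, ha⟩, c)) c).mpr (by simp)
      simp only at hcd
      rw [hcd, hmem] at h
      simpa using h
    · intro A hA
      obtain ⟨c, -, rfl⟩ := Finset.mem_image.mp hA
      rw [Finset.card_image_of_injective, Finset.card_univ, Fintype.card_fin]
      intro k l hkl
      simpa using hkl
    · rintro B ⟨hB, hi⟩
      obtain ⟨c, -, rfl⟩ := Finset.mem_image.mp hB
      rw [(hmem _ _).mp hi]⟩

lemma sameBlock_ofEquiv (ha : 0 < a) (e : Fin m ≃ Fin a × Fin b) (i j : Fin m) :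
    SameBlock (Partn.ofEquiv ha e) i j ↔ (e i).2 = (e j).2 := by
  constructor
  · rintro ⟨A, hA, hi, hj⟩
    obtain ⟨c, -, rfl⟩ := Finset.mem_image.mp hA
    obtain ⟨k, -, rfl⟩ := Finset.mem_image.mp hi
    obtain ⟨l, -, rfl⟩ := Finset.mem_image.mp hj
    simp
  · intro h
    refine ⟨_, Finset.mem_image_of_mem _ (Finset.mem_univ (e i).2),
      Finset.mem_image.mpr ⟨(e i).1, Finset.mem_univ _, by simp⟩,
      Finset.mem_image.mpr ⟨(e j).1, Finset.mem_univ _, by simp [h]⟩⟩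

lemma Partn.ofEquiv_eq (ha : 0 < a) {e e' : Fin m ≃ Fin a × Fin b}
    (h : ∀ i, (e i).2 = (e' i).2) : Partn.ofEquiv ha e = Partn.ofEquiv ha e' := by
  apply Subtype.ext
  refine Finset.image_congr fun c _ => ?_
  ext i
  simp only [Finset.mem_image, Finset.mem_univ, true_and]
  constructor
  · rintro ⟨k, rfl⟩
    exact ⟨(e' (e.symm (k, c))).1, by rw [Equiv.symm_apply_eq]; ext1 <;> simp [← h]⟩
  · rintro ⟨k, rfl⟩
    exact ⟨(e (e'.symm (k, c))).1, by rw [Equiv.symm_apply_eq]; ext1 <;> simp [h]⟩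

lemma Partn.smul_ofEquiv (ha : 0 < a) (e : Fin m ≃ Fin a × Fin b) (g : Perm (Fin m)) :
    g • Partn.ofEquiv ha e = Partn.ofEquiv ha (g.symm.trans e) := by
  apply Subtype.ext
  change g • Finset.univ.image _ = Finset.univ.image _
  rw [Finset.smul_finset_def, Finset.image_image]
  refine Finset.image_congr fun c _ => ?_
  simp only [Function.comp, Finset.smul_finset_def, Finset.image_image]
  rfl

/-- The size of the intersection of the blocks through a point of a grid `Fin a × Fin b`, for the
partition into columns and its image under `(k, c) ↦ (k, σ k c)`. -/
def twistSize (σ : Fin a → Perm (Fin b)) (u : Fin a × Fin b) : ℕ :=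
  (Finset.univ.filter fun k => σ k u.2 = σ u.1 u.2).card

/-- The number of points at which `twistSize σ` takes a given value. -/
def twistDistribution (σ : Fin a → Perm (Fin b)) (n : ℕ) : ℕ :=
  (Finset.univ.filter fun u => twistSize σ u = n).card

lemma cellDistribution_ofEquiv (ha : 0 < a) (e : Fin m ≃ Fin a × Fin b)
    (σ : Fin a → Perm (Fin b)) :
    cellDistribution (Partn.ofEquiv ha e)
      (Partn.ofEquiv ha (e.trans (Equiv.prodShear (Equiv.refl _) σ))) = twistDistribution σ := by
  funext n
  refine Finset.card_equiv e fun i => ?_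
  simp only [Finset.mem_filter, Finset.mem_univ, true_and]
  have h : cellSize (Partn.ofEquiv ha e)
      (Partn.ofEquiv ha (e.trans (Equiv.prodShear (Equiv.refl _) σ))) i = twistSize σ (e i) := by
    symm
    refine Finset.card_bij (fun k _ => e.symm (k, (e i).2)) ?_ ?_ ?_
    · intro k hk
      simp only [Finset.mem_filter, Finset.mem_univ, true_and] at hk
      simp [sameBlock_ofEquiv, hk]
    · intro k _ l _ hkl
      simpa using hkl
    · intro j hj
      simp only [Finset.mem_filter, Finset.mem_univ, true_and, sameBlock_ofEquiv] at hj
      refine ⟨(e j).1, ?_, by rw [hj.1]; simp⟩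
      have h2 := hj.2
      simp only [Equiv.trans_apply, Equiv.prodShear_apply, Equiv.refl_apply] at h2
      simp only [Finset.mem_filter, Finset.mem_univ, true_and]
      rw [h2, hj.1]
  rw [h]

lemma exists_isosceles_partn (ha : 0 < a) (hab : a * b = m) {σ : Fin a → Perm (Fin b)}
    {k l : Fin a} {c : Fin b} (hne : σ k c ≠ σ l c) (ζ : Perm (Fin a × Fin b))
    (hζ : ∀ k c, (ζ (k, σ k c)).2 = (ζ (k, c)).2) :
    ∃ x y z : Partn m a b, [x, y, z].Nodup ∧ cellDistribution x y = twistDistribution σ ∧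
      cellDistribution x z = cellDistribution y z := by
  let e : Fin m ≃ Fin a × Fin b := (finCongr hab.symm).trans finProdFinEquiv.symm
  let h : Perm (Fin a × Fin b) := Equiv.prodShear (Equiv.refl _) σ
  let g : Perm (Fin m) := ((e.trans h).trans e.symm).symm
  have hgx : g • Partn.ofEquiv ha e = Partn.ofEquiv ha (e.trans h) := by
    rw [Partn.smul_ofEquiv]
    exact Partn.ofEquiv_eq ha fun i => by simp [g]
  have hgz : g • Partn.ofEquiv ha (e.trans ζ) = Partn.ofEquiv ha (e.trans ζ) := by
    rw [Partn.smul_ofEquiv]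
    refine Partn.ofEquiv_eq ha fun i => ?_
    have := hζ (e i).1 (e i).2
    simpa [g, h] using this
  have hxy : Partn.ofEquiv ha e ≠ Partn.ofEquiv ha (e.trans h) := by
    intro heq
    have h1 := sameBlock_ofEquiv ha e (e.symm (k, c)) (e.symm (l, c))
    rw [heq, sameBlock_ofEquiv] at h1
    apply hne
    simpa [h] using h1
  refine ⟨Partn.ofEquiv ha e, Partn.ofEquiv ha (e.trans h), Partn.ofEquiv ha (e.trans ζ), ?_,
    cellDistribution_ofEquiv ha e σ, ?_⟩
  · have hxz : Partn.ofEquiv ha e ≠ Partn.ofEquiv ha (e.trans ζ) := by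
      intro heq
      rw [← heq, hgx] at hgz
      exact hxy hgz.symm
    have hyz : Partn.ofEquiv ha (e.trans h) ≠ Partn.ofEquiv ha (e.trans ζ) := by
      intro heq
      rw [← heq, ← hgx, smul_left_cancel_iff] at hgz
      exact hxy (hgz.symm.trans hgx)
    simp [hxy, hxz, hyz]
  · rw [← hgx, ← cellDistribution_smul g, hgz]

lemma twistDistribution_self {σ : Fin a → Perm (Fin b)} (S : Finset (Fin b))
    (h1 : ∀ c ∉ S, ∀ k l, σ k c = σ l c) (h2 : ∀ c ∈ S, ∀ k, ∃ l, σ l c ≠ σ k c) :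
    twistDistribution σ a = a * (b - S.card) := by
  have h : (Finset.univ.filter fun u => twistSize σ u = a) = Finset.univ ×ˢ Sᶜ := by
    ext ⟨k, c⟩
    simp only [Finset.mem_filter, Finset.mem_univ, true_and, Finset.mem_product,
      Finset.mem_compl]
    constructor
    · intro hc hS
      obtain ⟨l, hl⟩ := h2 c hS k
      have : twistSize σ (k, c) < Fintype.card (Fin a) := by
        refine Finset.card_lt_univ_of_notMem (x := l) ?_
        simpa using hl
      rw [hc, Fintype.card_fin] at this
      exact this.false
    · intro hc
      rw [twistSize, Finset.filter_true_of_mem fun l _ => h1 c hc l k]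
      simp
  rw [twistDistribution, h, Finset.card_product, Finset.card_compl]
  simp

/-- The partition into columns of a grid, its image under `(k, c) ↦ (k, σ k c)` and some third
partition span an isosceles triangle. -/
def IsoscelesTwist (σ : Fin a → Perm (Fin b)) : Prop :=
  (∃ k l c, σ k c ≠ σ l c) ∧
    ∃ ζ : Perm (Fin a × Fin b), ∀ k c, (ζ (k, σ k c)).2 = (ζ (k, c)).2

lemma exists_perm_snd_eq (M : Finset (Fin a × Fin b)) (hM : M.card ≤ a) (p : Fin b) :
    ∃ ζ : Perm (Fin a × Fin b), ∀ u ∈ M, (ζ u).2 = p := by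
  obtain ⟨T, hT, hTM⟩ := Finset.exists_subset_card_eq
    (s := (Finset.univ : Finset (Fin a)) ×ˢ ({p} : Finset (Fin b))) (n := M.card) (by simpa)
  let e : {u // u ∈ M} ≃ {u // u ∈ T} := Finset.equivOfCardEq hTM.symm
  refine ⟨e.extendSubtype, fun u hu => ?_⟩
  exact Finset.mem_singleton.mp (Finset.mem_product.mp (hT (e.extendSubtype_mem u hu))).2

lemma exists_perm_snd_eq_snd (ha : 2 ≤ a) (hb : 2 ≤ b) (hab : 6 ≤ a * b)
    {u u' v v' : Fin a × Fin b} (h : [u, u', v, v'].Nodup) :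
    ∃ ζ : Perm (Fin a × Fin b), (ζ u).2 = (ζ u').2 ∧ (ζ v).2 = (ζ v').2 := by
  let k : Fin a := ⟨0, by omega⟩
  let l : Fin a := ⟨1, by omega⟩
  let p : Fin b := ⟨0, by omega⟩
  let q : Fin b := ⟨1, by omega⟩
  obtain ⟨ζ, -, hζ⟩ := exists_even_map_eq (l' := [(k, p), (l, p), (k, q), (l, q)]) h
    (by simp [k, l, p, q]) rfl (by simpa using hab)
  simp only [List.map_cons, List.map_nil, List.cons.injEq, and_true] at hζ
  exact ⟨ζ, by rw [hζ.1, hζ.2.1], by rw [hζ.2.2.1, hζ.2.2.2]⟩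

/-- Exchange two columns in the rows belonging to `K`. -/
def exchangeTwist (K : Finset (Fin a)) (p q : Fin b) (k : Fin a) : Perm (Fin b) :=
  if k ∈ K then swap p q else 1

lemma exists_notMem_of_two_mul_card_le {K : Finset (Fin a)} (hK : K.Nonempty)
    (hKa : 2 * K.card ≤ a) : ∃ k, k ∉ K := by
  by_contra! h
  have := Finset.card_pos.mpr hK
  rw [Finset.eq_univ_iff_forall.mpr h, Finset.card_fin] at this hKa
  omega

lemma isoscelesTwist_exchangeTwist {K : Finset (Fin a)} (hK : K.Nonempty) (hKa : 2 * K.card ≤ a)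
    {p q : Fin b} (hpq : p ≠ q) : IsoscelesTwist (exchangeTwist K p q) := by
  constructor
  · obtain ⟨k, hk⟩ := hK
    obtain ⟨l, hl⟩ := exists_notMem_of_two_mul_card_le ⟨k, hk⟩ hKa
    exact ⟨k, l, p, by simp [exchangeTwist, hk, hl, hpq.symm]⟩
  · obtain ⟨ζ, hζ⟩ := exists_perm_snd_eq (K ×ˢ {p, q})
      (by rw [Finset.card_product, Finset.card_pair hpq]; omega) p
    refine ⟨ζ, fun k c => ?_⟩
    by_cases hk : k ∈ K
    · by_cases hc : c ∈ ({p, q} : Finset (Fin b))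
      · rw [hζ (k, c) (Finset.mem_product.mpr ⟨hk, hc⟩), hζ]
        refine Finset.mem_product.mpr ⟨hk, ?_⟩
        simp only [Finset.mem_insert, Finset.mem_singleton] at hc ⊢
        rcases hc with rfl | rfl <;> simp [exchangeTwist, hk]
      · simp only [Finset.mem_insert, Finset.mem_singleton, not_or] at hc
        simp [exchangeTwist, hk, swap_apply_of_ne_of_ne hc.1 hc.2]
    · simp [exchangeTwist, hk]

lemma twistDistribution_exchangeTwist_self {K : Finset (Fin a)} (hK : K.Nonempty)
    (hKa : 2 * K.card ≤ a) {p q : Fin b} (hpq : p ≠ q) :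
    twistDistribution (exchangeTwist K p q) a = a * (b - 2) := by
  rw [← Finset.card_pair hpq]
  apply twistDistribution_self
  · intro c hc k l
    simp only [Finset.mem_insert, Finset.mem_singleton, not_or] at hc
    simp only [exchangeTwist]
    split_ifs <;> simp [swap_apply_of_ne_of_ne hc.1 hc.2]
  · intro c hc k
    simp only [Finset.mem_insert, Finset.mem_singleton] at hc
    obtain ⟨k', hk'⟩ := hK
    obtain ⟨l, hl⟩ := exists_notMem_of_two_mul_card_le ⟨k', hk'⟩ hKa
    by_cases hk : k ∈ K
    · refine ⟨l, ?_⟩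
      rcases hc with rfl | rfl <;> simp [exchangeTwist, hk, hl, hpq, hpq.symm]
    · refine ⟨k', ?_⟩
      rcases hc with rfl | rfl <;> simp [exchangeTwist, hk, hk', hpq, hpq.symm]

lemma twistSize_exchangeTwist {K : Finset (Fin a)} {p q : Fin b} (hpq : p ≠ q) (k : Fin a)
    (c : Fin b) : twistSize (exchangeTwist K p q) (k, c) =
      if c = p ∨ c = q then (if k ∈ K then K.card else a - K.card) else a := by
  have hcompl : a - K.card = Kᶜ.card := by rw [Finset.card_compl, Fintype.card_fin]
  unfold twistSize
  split_ifs with hc hk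
  · congr 1
    ext l
    by_cases hl : l ∈ K <;> rcases hc with rfl | rfl <;>
      simp [exchangeTwist, hk, hl, hpq, hpq.symm]
  · rw [hcompl]
    congr 1
    ext l
    by_cases hl : l ∈ K <;> rcases hc with rfl | rfl <;>
      simp [exchangeTwist, hk, hl, hpq, hpq.symm]
  · rw [not_or] at hc
    rw [Finset.filter_true_of_mem, Finset.card_fin]
    intro l _
    simp only [exchangeTwist]
    split_ifs <;> simp [swap_apply_of_ne_of_ne hc.1 hc.2]

lemma twistDistribution_exchangeTwist_card_ne_zero {K : Finset (Fin a)} (hK : K.Nonempty)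
    {p q : Fin b} (hpq : p ≠ q) : twistDistribution (exchangeTwist K p q) K.card ≠ 0 := by
  obtain ⟨k, hk⟩ := hK
  rw [twistDistribution, Finset.card_ne_zero]
  exact ⟨(k, p), by simp [twistSize_exchangeTwist hpq, hk]⟩

lemma twistDistribution_exchangeTwist_eq_zero {K : Finset (Fin a)} {p q : Fin b} (hpq : p ≠ q)
    {n : ℕ} (h1 : n < K.card) (h2 : 2 * K.card ≤ a) :
    twistDistribution (exchangeTwist K p q) n = 0 := by
  rw [twistDistribution, Finset.card_eq_zero, Finset.filter_eq_empty_iff]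
  rintro ⟨k, c⟩ -
  rw [twistSize_exchangeTwist hpq]
  split_ifs <;> omega

lemma twistDistribution_exchangeTwist_ne {K L : Finset (Fin a)} {p q : Fin b} (hpq : p ≠ q)
    (hK : K.Nonempty) (hKL : K.card < L.card) (hL : 2 * L.card ≤ a) :
    twistDistribution (exchangeTwist K p q) ≠ twistDistribution (exchangeTwist L p q) := by
  intro h
  apply twistDistribution_exchangeTwist_card_ne_zero hK hpq
  rw [h, twistDistribution_exchangeTwist_eq_zero hpq hKL hL]

/-- Exchange one point of the column `r` with a point of `p`, another one with a point of `q`. -/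
def tripleTwist (k₀ k₁ : Fin a) (p q r : Fin b) (k : Fin a) : Perm (Fin b) :=
  if k = k₀ then swap p r else if k = k₁ then swap q r else 1

lemma tripleTwist_apply (k₀ k₁ : Fin a) (p q r : Fin b) (k : Fin a) (c : Fin b) :
    tripleTwist k₀ k₁ p q r k c =
      if k = k₀ then (if c = p then r else if c = r then p else c)
      else if k = k₁ then (if c = q then r else if c = r then q else c) else c := by
  unfold tripleTwist
  split_ifs <;> simp_all [swap_apply_def]

lemma isoscelesTwist_tripleTwist (hb : 2 ≤ b) (hab : 6 ≤ a * b) {k₀ k₁ : Fin a} (hk : k₀ ≠ k₁)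
    {p q r : Fin b} (h : [p, q, r].Nodup) : IsoscelesTwist (tripleTwist k₀ k₁ p q r) := by
  simp only [List.nodup_cons, List.mem_cons, List.not_mem_nil, or_false, not_or,
    List.nodup_nil, not_false_eq_true, and_true] at h
  obtain ⟨⟨hpq, hpr⟩, hqr⟩ := h
  constructor
  · refine ⟨k₀, k₁, p, ?_⟩
    simp [tripleTwist_apply, hk.symm, hpq, hpr, Ne.symm hpr]
  · obtain ⟨ζ, h1, h2⟩ := exists_perm_snd_eq_snd (by have := k₀.2; have := k₁.2; omega) hb hab
      (u := (k₀, p)) (u' := (k₀, r)) (v := (k₁, q)) (v' := (k₁, r))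
      (by simp [hk, hpr, hqr])
    refine ⟨ζ, fun k c => ?_⟩
    rw [tripleTwist_apply]
    split_ifs <;> simp_all

lemma twistDistribution_tripleTwist_self {k₀ k₁ : Fin a} (hk : k₀ ≠ k₁)
    {p q r : Fin b} (h : [p, q, r].Nodup) :
    twistDistribution (tripleTwist k₀ k₁ p q r) a = a * (b - 3) := by
  have hcard : ({p, q, r} : Finset (Fin b)).card = 3 := by
    simpa using List.toFinset_card_of_nodup h
  simp only [List.nodup_cons, List.mem_cons, List.not_mem_nil, or_false, not_or,
    List.nodup_nil, not_false_eq_true, and_true] at h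
  obtain ⟨⟨hpq, hpr⟩, hqr⟩ := h
  rw [← hcard]
  apply twistDistribution_self
  · intro c hc k l
    simp only [Finset.mem_insert, Finset.mem_singleton, not_or] at hc
    simp [tripleTwist_apply, hc]
  · intro c hc k
    simp only [Finset.mem_insert, Finset.mem_singleton] at hc
    refine ⟨if k = k₀ ∨ c = q ∧ k ≠ k₁ then k₁ else k₀, ?_⟩
    rw [tripleTwist_apply, tripleTwist_apply]
    grind

/-- Exchange the columns `p`, `q` and the columns `r`, `s` in a single row. -/
def quadrupleTwist (k₀ : Fin a) (p q r s : Fin b) (k : Fin a) : Perm (Fin b) :=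
  if k = k₀ then swap p q * swap r s else 1

lemma quadrupleTwist_apply (k₀ : Fin a) {p q r s : Fin b} (h : [p, q, r, s].Nodup) (k : Fin a)
    (c : Fin b) : quadrupleTwist k₀ p q r s k c =
      if k = k₀ then
        (if c = p then q else if c = q then p else if c = r then s else if c = s then r else c)
      else c := by
  simp only [List.nodup_cons, List.mem_cons, List.not_mem_nil, or_false, not_or] at h
  by_cases hk : k = k₀
  · simp only [quadrupleTwist, hk, if_true, Perm.mul_apply, swap_apply_def]
    grind
  · simp [quadrupleTwist, hk]

lemma isoscelesTwist_quadrupleTwist (hb : 2 ≤ b) (hab : 6 ≤ a * b) {k₀ k₁ : Fin a}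
    (hk : k₀ ≠ k₁) {p q r s : Fin b} (h : [p, q, r, s].Nodup) :
    IsoscelesTwist (quadrupleTwist k₀ p q r s) := by
  constructor
  · refine ⟨k₀, k₁, p, ?_⟩
    simp only [quadrupleTwist_apply k₀ h, hk.symm, if_true, if_false]
    clear * - h
    grind
  · obtain ⟨ζ, h1, h2⟩ := exists_perm_snd_eq_snd (by have := k₀.2; have := k₁.2; omega) hb hab
      (u := (k₀, p)) (u' := (k₀, q)) (v := (k₀, r)) (v' := (k₀, s))
      (h.map (Prod.mk_right_injective k₀))
    refine ⟨ζ, fun k c => ?_⟩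
    rw [quadrupleTwist_apply k₀ h]
    clear h
    split_ifs <;> simp_all

lemma twistDistribution_quadrupleTwist_self {k₀ k₁ : Fin a} (hk : k₀ ≠ k₁)
    {p q r s : Fin b} (h : [p, q, r, s].Nodup) :
    twistDistribution (quadrupleTwist k₀ p q r s) a = a * (b - 4) := by
  have hcard : ({p, q, r, s} : Finset (Fin b)).card = 4 := by
    simpa using List.toFinset_card_of_nodup h
  rw [← hcard]
  apply twistDistribution_self
  · intro c hc k l
    simp only [Finset.mem_insert, Finset.mem_singleton, not_or] at hc
    simp [quadrupleTwist_apply k₀ h, hc]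
  · intro c hc k
    simp only [Finset.mem_insert, Finset.mem_singleton] at hc
    refine ⟨if k = k₀ then k₁ else k₀, ?_⟩
    rw [quadrupleTwist_apply k₀ h, quadrupleTwist_apply k₀ h]
    simp only [List.nodup_cons, List.mem_cons, List.not_mem_nil, or_false, not_or] at h
    grind

lemma exists_isoscelesTwist (ha : 2 ≤ a) (hb : 2 ≤ b) (hab : 11 ≤ a * b) :
    ∃ σ : Fin 3 → Fin a → Perm (Fin b),
      Function.Injective (fun i => twistDistribution (σ i)) ∧ ∀ i, IsoscelesTwist (σ i) := by
  have key : ∀ σ₁ σ₂ σ₃ : Fin a → Perm (Fin b), IsoscelesTwist σ₁ → IsoscelesTwist σ₂ →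
      IsoscelesTwist σ₃ → twistDistribution σ₁ ≠ twistDistribution σ₂ →
      twistDistribution σ₁ ≠ twistDistribution σ₃ →
      twistDistribution σ₂ ≠ twistDistribution σ₃ →
      ∃ σ : Fin 3 → Fin a → Perm (Fin b),
        Function.Injective (fun i => twistDistribution (σ i)) ∧ ∀ i, IsoscelesTwist (σ i) := by
    intro σ₁ σ₂ σ₃ h1 h2 h3 h12 h13 h23
    refine ⟨![σ₁, σ₂, σ₃], fun i j hij => ?_, fun i => by fin_cases i <;> assumption⟩
    by_contra hne
    fin_cases i <;> fin_cases j <;> simp_all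
  have hrows : ∀ j ≤ a, ∃ K : Finset (Fin a), K.card = j := fun j hj => by
    obtain ⟨K, -, hK⟩ := Finset.exists_subset_card_eq (s := (Finset.univ : Finset (Fin a)))
      (n := j) (by simpa)
    exact ⟨K, hK⟩
  obtain ⟨K₁, hK₁⟩ := hrows 1 (by omega)
  obtain ⟨K₂, hK₂⟩ := hrows 2 (by omega)
  have hn₁ : K₁.Nonempty := Finset.card_pos.mp (by omega)
  have hn₂ : K₂.Nonempty := Finset.card_pos.mp (by omega)
  let k₀ : Fin a := ⟨0, by omega⟩
  let k₁ : Fin a := ⟨1, by omega⟩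
  have hk : k₀ ≠ k₁ := by simp [k₀, k₁]
  let p : Fin b := ⟨0, by omega⟩
  let q : Fin b := ⟨1, by omega⟩
  have hpq : p ≠ q := by simp [p, q]
  have hmul : ∀ i j, i ≠ j → i ≤ b → j ≤ b → a * (b - i) ≠ a * (b - j) := by
    intro i j hij hi hj h
    have := Nat.eq_of_mul_eq_mul_left (by omega) h
    omega
  have hne : ∀ {σ τ : Fin a → Perm (Fin b)} {i j : ℕ}, twistDistribution σ a = a * (b - i) →
      twistDistribution τ a = a * (b - j) → i ≠ j → i ≤ b → j ≤ b →
      twistDistribution σ ≠ twistDistribution τ := by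
    intro σ τ i j h1 h2 hij hi hj h
    exact hmul i j hij hi hj (by rw [← h1, ← h2, h])
  rcases (by omega : b = 2 ∨ b = 3 ∨ 4 ≤ b) with hb2 | hb3 | hb4
  · have ha6 : 6 ≤ a := by rw [hb2] at hab; omega
    obtain ⟨K₃, hK₃⟩ := hrows 3 (by omega)
    have hn₃ : K₃.Nonempty := Finset.card_pos.mp (by omega)
    refine key _ _ _ (isoscelesTwist_exchangeTwist hn₁ (by omega) hpq)
      (isoscelesTwist_exchangeTwist hn₂ (by omega) hpq)
      (isoscelesTwist_exchangeTwist hn₃ (by omega) hpq) ?_ ?_ ?_ <;>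
    · apply twistDistribution_exchangeTwist_ne hpq <;> first | assumption | omega
  · have ha4 : 4 ≤ a := by rw [hb3] at hab; omega
    let r : Fin b := ⟨2, by omega⟩
    have hnd : [p, q, r].Nodup := by simp [p, q, r]
    refine key _ _ _ (isoscelesTwist_exchangeTwist hn₁ (by omega) hpq)
      (isoscelesTwist_exchangeTwist hn₂ (by omega) hpq)
      (isoscelesTwist_tripleTwist hb (by omega) hk hnd) ?_ ?_ ?_
    · exact twistDistribution_exchangeTwist_ne hpq hn₁ (by omega) (by omega)
    · exact hne (twistDistribution_exchangeTwist_self hn₁ (by omega) hpq)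
        (twistDistribution_tripleTwist_self hk hnd) (by omega) (by omega) (by omega)
    · exact hne (twistDistribution_exchangeTwist_self hn₂ (by omega) hpq)
        (twistDistribution_tripleTwist_self hk hnd) (by omega) (by omega) (by omega)
  · let r : Fin b := ⟨2, by omega⟩
    let s : Fin b := ⟨3, by omega⟩
    have hnd : [p, q, r].Nodup := by simp [p, q, r]
    have hnd' : [p, q, r, s].Nodup := by simp [p, q, r, s]
    refine key _ _ _ (isoscelesTwist_exchangeTwist hn₁ (by omega) hpq)
      (isoscelesTwist_tripleTwist hb (by omega) hk hnd)
      (isoscelesTwist_quadrupleTwist hb (by omega) hk hnd') ?_ ?_ ?_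
    · exact hne (twistDistribution_exchangeTwist_self hn₁ (by omega) hpq)
        (twistDistribution_tripleTwist_self hk hnd) (by omega) (by omega) (by omega)
    · exact hne (twistDistribution_exchangeTwist_self hn₁ (by omega) hpq)
        (twistDistribution_quadrupleTwist_self hk hnd') (by omega) (by omega) (by omega)
    · exact hne (twistDistribution_tripleTwist_self hk hnd)
        (twistDistribution_quadrupleTwist_self hk hnd') (by omega) (by omega) (by omega)

variable {F V : Type*} [Field F] [IsAlgClosed F] [CharP F 2] [AddCommGroup V] [Module F V]

theorem three_cycle_sum_eq_zero_of_partitions (hm : 11 ≤ m) (ha : 2 ≤ a) (hb : 2 ≤ b)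
    (hab : a * b = m) (hcard : 9 ≤ Fintype.card (Partn m a b))
    {hX : (MulAction.toPermHom (alternatingGroup (Fin m)) (Partn m a b)).range ≤
      alternatingGroup (Partn m a b)}
    (ρ : Representation F (alternatingGroup (Partn m a b)) V)
    (hirr : RepIrreducible (ρ.comp (Subgroup.inclusion hX))) (hV : 1 < Module.rank F V)
    {x y z : Partn m a b} (hxyz : [x, y, z].Nodup) :
    1 + altOp ρ (swap x y * swap y z) +
      altOp ρ (swap x y * swap y z) * altOp ρ (swap x y * swap y z) = 0 := by
  obtain ⟨σ, hσ, hiso⟩ := exists_isoscelesTwist ha hb (hab ▸ hm)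
  refine three_cycle_sum_eq_zero_of_invariant ρ hirr hV hcard cellDistribution
    cellDistribution_comm ?_ _ hσ ?_ hxyz
  · intro g hg P Q
    obtain ⟨τ, hτ⟩ := exists_perm_of_mem_range hg
    rw [hτ, hτ, cellDistribution_smul]
  · intro i
    obtain ⟨⟨k, l, c, hne⟩, ζ, hζ⟩ := hiso i
    exact exists_isosceles_partn (by omega) hab hne ζ hζ

end Partitions

section CardPartitions

open Equiv Equiv.Perm

variable {m a b : ℕ}

lemma Partn.block_unique (P : Partn m a b) {A B : Finset (Fin m)} {i : Fin m} (hA : A ∈ P.1)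
    (hB : B ∈ P.1) (hiA : i ∈ A) (hiB : i ∈ B) : A = B :=
  (P.2.2.2 i).unique ⟨hA, hiA⟩ ⟨hB, hiB⟩

lemma nonempty_partn (ha : 0 < a) (hab : a * b = m) : Nonempty (Partn m a b) :=
  ⟨Partn.ofEquiv ha ((finCongr hab.symm).trans finProdFinEquiv.symm)⟩

lemma exists_partn_mem (ha : 0 < a) (hb : 0 < b) (hab : a * b = m) {T : Finset (Fin m)}
    (hT : T.card = a) : ∃ P : Partn m a b, T ∈ P.1 := by
  obtain ⟨P⟩ := nonempty_partn ha hab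
  obtain ⟨A, hA⟩ : P.1.Nonempty := Finset.card_pos.mp (by rw [P.2.1]; exact hb)
  let e : {i // i ∈ A} ≃ {i // i ∈ T} := Finset.equivOfCardEq ((P.2.2.1 A hA).trans hT.symm)
  refine ⟨(e.extendSubtype : Perm (Fin m)) • P, ?_⟩
  have h : (e.extendSubtype : Perm (Fin m)) • A = T := by
    refine Finset.eq_of_subset_of_card_le ?_ ?_
    · intro i hi
      obtain ⟨j, hj, rfl⟩ := Finset.mem_smul_finset.mp hi
      exact e.extendSubtype_mem j hj
    · rw [Finset.card_smul_finset, hT, P.2.2.1 A hA]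
  have hmem := Finset.smul_mem_smul_finset (s := P.1) (a := (e.extendSubtype : Perm (Fin m))) hA
  rw [h] at hmem
  exact hmem

lemma exists_partn_pair_mem (hb : 2 ≤ b) (hb2 : 2 * b = m) (hm : 6 ≤ m) {i j k l : Fin m}
    (h : [i, j, k, l].Nodup) : ∃ P : Partn m 2 b, {i, j} ∈ P.1 ∧ {k, l} ∈ P.1 := by
  obtain ⟨P⟩ := nonempty_partn two_pos hb2
  obtain ⟨A, hA, B, hB, hAB⟩ := Finset.one_lt_card.mp (show 1 < P.1.card by rw [P.2.1]; exact hb)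
  obtain ⟨i', j', hij, rfl⟩ := Finset.card_eq_two.mp (P.2.2.1 A hA)
  obtain ⟨k', l', hkl, rfl⟩ := Finset.card_eq_two.mp (P.2.2.1 B hB)
  have hdis : ∀ u ∈ ({i', j'} : Finset (Fin m)), u ∉ ({k', l'} : Finset (Fin m)) :=
    fun u hu hu' => hAB (P.block_unique hA hB hu hu')
  simp only [Finset.mem_insert, Finset.mem_singleton, forall_eq_or_imp, forall_eq, not_or] at hdis
  obtain ⟨g, -, hg⟩ := exists_even_map_eq (l := [i', j', k', l']) (l' := [i, j, k, l])
    (by simp [hij, hkl, hdis]) h rfl (by simpa using hm)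
  simp only [List.map_cons, List.map_nil, List.cons.injEq, and_true] at hg
  have hsmul : ∀ u v : Fin m, g • ({u, v} : Finset (Fin m)) = {g u, g v} := fun u v => by
    rw [Finset.smul_finset_insert, Finset.smul_finset_singleton]; rfl
  refine ⟨g • P, ?_, ?_⟩
  · rw [← hg.1, ← hg.2.1, ← hsmul]
    exact Finset.smul_mem_smul_finset (s := P.1) hA
  · rw [← hg.2.2.1, ← hg.2.2.2, ← hsmul]
    exact Finset.smul_mem_smul_finset (s := P.1) hB

lemma choose_le_card_partn (ha : 0 < a) (hb : 0 < b) (hab : a * b = m) :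
    (m - 1).choose (a - 1) ≤ Fintype.card (Partn m a b) := by
  have hm : 0 < m := hab ▸ Nat.mul_pos ha hb
  let o : Fin m := ⟨0, hm⟩
  have hex : ∀ T ∈ Finset.powersetCard (a - 1) (Finset.univ.erase o),
      ∃ P : Partn m a b, insert o T ∈ P.1 := by
    intro T hT
    rw [Finset.mem_powersetCard] at hT
    refine exists_partn_mem ha hb hab ?_
    rw [Finset.card_insert_of_notMem fun h => Finset.notMem_erase o _ (hT.1 h), hT.2]
    omega
  have := nonempty_partn ha hab
  choose! f hf using hex
  have h := Finset.card_le_card_of_injOn (t := Finset.univ) f (fun _ _ => Finset.mem_univ _) (by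
    intro S hS T hT hST
    have hmem := hf S hS
    rw [hST] at hmem
    have heq := (f T).block_unique hmem (hf T hT) (Finset.mem_insert_self o S)
      (Finset.mem_insert_self o T)
    rw [Finset.mem_coe, Finset.mem_powersetCard] at hS hT
    rw [← Finset.erase_insert fun h => Finset.notMem_erase o _ (hS.1 h), heq,
      Finset.erase_insert fun h => Finset.notMem_erase o _ (hT.1 h)])
  rw [Finset.card_powersetCard, Finset.card_erase_of_mem (Finset.mem_univ o), Finset.card_fin,
    Finset.card_univ] at h
  exact h

lemma card_partn_two_ge (hb : 2 ≤ b) (hb2 : 2 * b = m) (hm : 6 ≤ m) :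
    (m - 2) * (m - 3) ≤ Fintype.card (Partn m 2 b) := by
  let o : Fin m := ⟨0, by omega⟩
  let o' : Fin m := ⟨1, by omega⟩
  have hoo : o ≠ o' := by simp [o, o']
  have hex : ∀ w ∈ ({o, o'} : Finset (Fin m))ᶜ.offDiag,
      ∃ P : Partn m 2 b, {o, w.1} ∈ P.1 ∧ {o', w.2} ∈ P.1 := by
    rintro ⟨i, j⟩ hw
    simp only [Finset.mem_offDiag, Finset.mem_compl, Finset.mem_insert, Finset.mem_singleton,
      not_or] at hw
    refine exists_partn_pair_mem hb hb2 hm ?_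
    clear * - hw hoo
    grind
  have := nonempty_partn two_pos hb2
  choose! f hf hf' using hex
  have hpair : ∀ {u v w : Fin m}, v ≠ u → ({u, v} : Finset (Fin m)) = {u, w} → v = w := by
    intro u v w hv h
    have hmem : v ∈ ({u, w} : Finset (Fin m)) := h ▸ by simp
    simpa [hv] using hmem
  have h := Finset.card_le_card_of_injOn (t := Finset.univ) f (fun _ _ => Finset.mem_univ _) (by
    intro w hw w' hw' heq
    have h1 := hf w hw
    have h2 := hf' w hw
    rw [heq] at h1 h2
    have e1 := (f w').block_unique h1 (hf w' hw') (i := o) (by simp) (by simp)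
    have e2 := (f w').block_unique h2 (hf' w' hw') (i := o') (by simp) (by simp)
    simp only [Finset.coe_offDiag, Set.mem_offDiag, Finset.coe_compl, Set.mem_compl_iff,
      Finset.mem_coe, Finset.mem_insert, Finset.mem_singleton, not_or] at hw
    exact Prod.ext (hpair hw.1.1 e1) (hpair hw.2.1.2 e2))
  rw [Finset.offDiag_card, Finset.card_compl, Finset.card_pair hoo, Fintype.card_fin,
    Finset.card_univ] at h
  have e : (m - 2) * (m - 3) = (m - 2) * (m - 2) - (m - 2) := by
    rw [show m - 3 = m - 2 - 1 by omega, Nat.mul_sub_one]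
  omega

lemma card_partn_ge (hm : 11 ≤ m) (ha : 2 ≤ a) (hb : 2 ≤ b) (hab : a * b = m) :
    (m - 1) * (m - 2) ≤ 2 * Fintype.card (Partn m a b) := by
  rcases (by omega : a = 2 ∨ 3 ≤ a) with rfl | ha3
  · have h := card_partn_two_ge hb hab (by omega)
    have h2 : (m - 2) * (m - 1) ≤ (m - 2) * (2 * (m - 3)) := Nat.mul_le_mul_left _ (by omega)
    rw [mul_comm (m - 1)]
    refine h2.trans ?_
    rw [Nat.mul_left_comm]
    exact Nat.mul_le_mul_left _ h
  · have h := choose_le_card_partn (by omega : 0 < a) (by omega : 0 < b) hab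
    have ham : 2 * a ≤ m := by rw [mul_comm, ← hab]; exact Nat.mul_le_mul_left a hb
    have h2 := choose_two_le_choose (n := m - 1) (k := a - 1) (by omega) (by omega)
    have h3 := Nat.choose_two_right (m - 1)
    have h4 : (m - 1) * (m - 1 - 1) / 2 * 2 = (m - 1) * (m - 1 - 1) :=
      Nat.div_mul_cancel (Nat.even_mul_pred_self (m - 1)).two_dvd
    have h5 : m - 1 - 1 = m - 2 := by omega
    rw [h5] at h3 h4
    omega

end CardPartitions

/-- let `F` be algebraically closed of characteristic 2, `m ≥ 11`, and let
`A_m` act naturally on a set `Ω` with `|Ω| = n > m`, where `Ω` is either the set of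
`k`-element subsets of `{1, ..., m}` (`2 ≤ k < m/2`) or the set of partitions of
`{1, ..., m}` into `b` subsets of size `a` (`a, b ≥ 2`, `ab = m`). Let `X ≤ Alt(Ω)` be
the image of `A_m`. Then every `F Alt(Ω)`-module `V` with `dim V > 1` is reducible as an
`F X`-module. -/
theorem stmt14 (F : Type*) [Field F] [IsAlgClosed F] [CharP F 2]
    (m : ℕ) (hm : 11 ≤ m) :
    (∀ k, 2 ≤ k → 2 * k < m → m < Nat.card (KSub m k) →
      ∃ hX : (MulAction.toPermHom (alternatingGroup (Fin m)) (KSub m k)).range ≤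
          alternatingGroup (KSub m k),
        ∀ (V : Type u) [AddCommGroup V] [Module F V]
          (ρ : Representation F (alternatingGroup (KSub m k)) V),
          1 < Module.rank F V →
          ¬ RepIrreducible (ρ.comp (Subgroup.inclusion hX))) ∧
    (∀ a b, 2 ≤ a → 2 ≤ b → a * b = m → m < Nat.card (Partn m a b) →
      ∃ hX : (MulAction.toPermHom (alternatingGroup (Fin m)) (Partn m a b)).range ≤
          alternatingGroup (Partn m a b),
        ∀ (V : Type u) [AddCommGroup V] [Module F V]
          (ρ : Representation F (alternatingGroup (Partn m a b)) V),
          1 < Module.rank F V →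
          ¬ RepIrreducible (ρ.comp (Subgroup.inclusion hX))) := by
  refine ⟨fun k hk hkm _ => ⟨range_toPermHom_le_alternatingGroup, fun V _ _ ρ hV =>
      not_repIrreducible_of_three_cycle_sum hm _ _ ρ hV (card_KSub_ge hk hkm)
        fun hirr x y z h => ?_⟩,
    fun a b ha hb hab _ => ⟨range_toPermHom_le_alternatingGroup, fun V _ _ ρ hV =>
      not_repIrreducible_of_three_cycle_sum hm _ _ ρ hV (card_partn_ge hm ha hb hab)
        fun hirr x y z h => ?_⟩⟩
  · rcases (by omega : k = 2 ∨ 3 ≤ k) with rfl | hk3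
    · exact three_cycle_sum_eq_zero_of_pairs hm ρ hirr hV h
    · exact three_cycle_sum_eq_zero_of_subsets hm hk3 hkm ρ hirr hV h
  · have hcard := card_partn_ge hm ha hb hab
    have hsize : 10 * 9 ≤ (m - 1) * (m - 2) := Nat.mul_le_mul (by omega) (by omega)
    exact three_cycle_sum_eq_zero_of_partitions hm ha hb hab (by omega) ρ hirr hV h
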